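/- Let K ⊆ ℝ² be a λ-convex body and L ⊆ ℝ² the λ-convex lens (intersection of two disks of radius 1/λ). If the perimeters satisfy |∂K| = |∂L|, then the areas satisfy |K| ≥ |L|, with equality if and only if K is a λ-convex lens. -/

import Mathlib

open scoped MeasureTheory
open MeasureTheory

/-- A convex body `K ⊆ ℝⁿ` is `λ`-convex (in the barrier sense) if at every boundary
point `p` there is a locally supporting ball of radius `1/λ` through `p`. -/
def IsLambdaConvex {n : ℕ} (lam : ℝ) (K : Set (EuclideanSpace ℝ (Fin n))) : Prop :=
  ∀ p ∈ frontier K, ∃ U ∈ nhds p, ∃ z : EuclideanSpace ℝ (Fin n),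
    dist p z = 1 / lam ∧ U ∩ frontier K ⊆ Metric.closedBall z (1 / lam)

/-- A `λ`-convex lens: the intersection of two closed balls of radius `1/λ` whose
centers are at distance less than `2/λ`. -/
def IsLens {n : ℕ} (lam : ℝ) (L : Set (EuclideanSpace ℝ (Fin n))) : Prop :=
  ∃ c₁ c₂ : EuclideanSpace ℝ (Fin n), dist c₁ c₂ < 2 / lam ∧
    L = Metric.closedBall c₁ (1 / lam) ∩ Metric.closedBall c₂ (1 / lam)

open Set Filter Topology

theorem monotone_of_frequently_lt {f : ℝ → ℝ} (hf : Continuous f) {E : Set ℝ} (hE : E.Countable)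
    (h : ∀ x ∉ E, ∃ᶠ z in 𝓝[>] x, f x < f z) : Monotone f := by
  intro a b hab
  by_contra! hlt
  have hsub : Ioo (f b) (f a) ⊆ f '' E := by
    intro y hy
    have hcomp : IsCompact (Icc a b ∩ f ⁻¹' Ici y) :=
      isCompact_Icc.inter_right (isClosed_Ici.preimage hf)
    obtain ⟨x, ⟨hx, hxy⟩, hmax⟩ := hcomp.exists_isGreatest ⟨a, ⟨le_rfl, hab⟩, hy.2.le⟩
    have hxy : y ≤ f x := hxy
    have hxb : x < b := lt_of_le_of_ne hx.2 (by rintro rfl; exact absurd hxy (not_le.2 hy.1))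
    have hev : ∀ᶠ z in 𝓝[>] x, f z < y := by
      filter_upwards [Ioc_mem_nhdsGT hxb] with z hz
      by_contra! hyz
      exact absurd (hmax ⟨⟨hx.1.trans hz.1.le, hz.2⟩, hyz⟩) (not_le.2 hz.1)
    have hle : f x ≤ y :=
      le_of_tendsto (hf.continuousWithinAt.tendsto (s := Ioi x)) (hev.mono fun _ h => h.le)
    refine ⟨x, ?_, le_antisymm hle hxy⟩
    by_contra hxE
    obtain ⟨z, hz1, hz2⟩ := ((h x hxE).and_eventually hev).exists
    linarith
  have : (Ioo (f b) (f a)).Countable := (hE.image f).mono hsub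
  exact absurd (Cardinal.Real.Ioo_countable_iff.1 this) (not_le.2 hlt)

theorem monotone_of_frequently_slope {f : ℝ → ℝ} (hf : Continuous f) {E : Set ℝ}
    (hE : E.Countable)
    (h : ∀ x ∉ E, ∀ ε > 0, ∃ᶠ z in 𝓝[>] x, -ε * (z - x) ≤ f z - f x) : Monotone f := by
  intro a b hab
  have key : ∀ ε > 0, f a + ε * a ≤ f b + ε * b := by
    intro ε hε
    refine monotone_of_frequently_lt (f := fun x => f x + ε * x) (by fun_prop) hE ?_ hab
    intro x hx
    refine ((h x hx (ε / 2) (by positivity)).and_eventually self_mem_nhdsWithin).mono ?_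
    rintro z ⟨hz, hxz⟩
    have : 0 < ε * (z - x) := mul_pos hε (sub_pos.2 hxz)
    nlinarith
  have ht : Tendsto (fun ε : ℝ => f b + ε * b - (f a + ε * a)) (𝓝[>] 0) (𝓝 (f b - f a)) := by
    have : Continuous fun ε : ℝ => f b + ε * b - (f a + ε * a) := by fun_prop
    simpa using (this.continuousWithinAt (s := Ioi 0) (x := 0)).tendsto
  have := ge_of_tendsto ht (b := 0) (by
    filter_upwards [self_mem_nhdsWithin] with ε hε
    linarith [key ε hε])
  linarith

/-- A `C¹` function which is locally supported from below by sinusoids with the same value and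
slope satisfies `m'' + m ≥ 0` in the integrated sense. -/
theorem monotone_deriv_add_integral {m n : ℝ → ℝ} (hm : ∀ x, HasDerivAt m (n x) x)
    (hn : Continuous n) {E : Set ℝ} (hE : E.Countable)
    (h : ∀ x ∉ E, ∀ᶠ y in 𝓝[>] x, m x * Real.cos (y - x) + n x * Real.sin (y - x) ≤ m y) :
    Monotone fun x => n x + ∫ t in (0 : ℝ)..x, m t := by
  have hmc : Continuous m := continuous_iff_continuousAt.2 fun x => (hm x).continuousAt
  have hI : ∀ x, HasDerivAt (fun y => ∫ t in (0 : ℝ)..y, m t) (m x) x := fun x =>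
    intervalIntegral.integral_hasDerivAt_right (hmc.intervalIntegrable _ _)
      (hmc.stronglyMeasurableAtFilter _ _) hmc.continuousAt
  have hIc : Continuous fun y => ∫ t in (0 : ℝ)..y, m t :=
    continuous_iff_continuousAt.2 fun x => (hI x).continuousAt
  refine monotone_of_frequently_slope (hn.add hIc) hE ?_
  intro x hx ε hε
  have hfreq : ∃ᶠ z in 𝓝[>] x, 0 ≤ n z + m x * Real.sin (z - x) - n x * Real.cos (z - x) := by
    rw [frequently_iff]
    intro U hU
    obtain ⟨b, hb, hbU⟩ := (mem_nhdsGT_iff_exists_Ioo_subset).1 hU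
    have hb : x < b := hb
    obtain ⟨z, hz, hzb⟩ := ((h x hx).and (Ioo_mem_nhdsGT hb)).exists
    have hD : ∀ w, HasDerivAt
        (fun y => m y - (m x * Real.cos (y - x) + n x * Real.sin (y - x)))
        (n w + m x * Real.sin (w - x) - n x * Real.cos (w - x)) w := by
      intro w
      have h1 : HasDerivAt (fun y => y - x) 1 w := (hasDerivAt_id w).sub_const x
      exact ((hm w).sub ((h1.cos.const_mul (m x)).add (h1.sin.const_mul (n x)))).congr_deriv
        (by ring)
    obtain ⟨c, hc, hc'⟩ := exists_hasDerivAt_eq_slope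
      (fun y => m y - (m x * Real.cos (y - x) + n x * Real.sin (y - x))) _ hzb.1
      (fun w _ => (hD w).continuousAt.continuousWithinAt) (fun w _ => hD w)
    refine ⟨c, hbU ⟨hc.1, hc.2.trans hzb.2⟩, ?_⟩
    rw [hc']
    apply div_nonneg _ (sub_pos.2 hzb.1).le
    simp only [sub_self, Real.cos_zero, Real.sin_zero]
    linarith
  have hL : HasDerivAt (fun y => n x * Real.cos (y - x) - m x * Real.sin (y - x)
      + ∫ t in (0 : ℝ)..y, m t) 0 x := by
    have h1 : HasDerivAt (fun y => y - x) 1 x := (hasDerivAt_id x).sub_const x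
    exact (((h1.cos.const_mul (n x)).sub (h1.sin.const_mul (m x))).add (hI x)).congr_deriv
      (by simp)
  have hev := (hL.isLittleO.def hε).filter_mono (nhdsWithin_le_nhds (s := Ioi x))
  refine ((hfreq.and_eventually hev).and_eventually self_mem_nhdsWithin).mono ?_
  rintro z ⟨⟨h1, h2⟩, hz⟩
  have hz : 0 < z - x := sub_pos.2 hz
  simp only [sub_self, Real.cos_zero, Real.sin_zero, smul_zero, Real.norm_eq_abs,
    abs_of_pos hz, sub_zero] at h2
  have := (abs_le.1 h2).1
  linarith

/-- A nondecreasing nonexpansive function on the line: arc length as a function of the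
normal angle. -/
structure IsArcLength (S : ℝ → ℝ) : Prop where
  mono : Monotone S
  sub_le : ∀ x y, x ≤ y → S y - S x ≤ y - x

theorem AbsolutelyContinuousOnInterval.integral_eq_sub_of_ae {f g : ℝ → ℝ} {a b : ℝ}
    (hf : AbsolutelyContinuousOnInterval f a b) (h : ∀ᵐ x, x ∈ uIcc a b → HasDerivAt f (g x) x) :
    ∫ x in a..b, g x = f b - f a := by
  rw [← hf.integral_deriv_eq_sub]
  apply intervalIntegral.integral_congr_ae
  filter_upwards [h] with x hx hx'
  exact (hx (uIoc_subset_uIcc hx')).deriv.symm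

namespace IsArcLength

variable {S : ℝ → ℝ} (hS : IsArcLength S)
include hS

theorem abs_sub_le (x y : ℝ) : |S x - S y| ≤ |x - y| := by
  rcases le_total x y with h | h
  · rw [abs_sub_comm, abs_sub_comm x, abs_of_nonneg (sub_nonneg.2 h),
      abs_of_nonneg (sub_nonneg.2 (hS.mono h))]
    exact hS.sub_le x y h
  · rw [abs_of_nonneg (sub_nonneg.2 h), abs_of_nonneg (sub_nonneg.2 (hS.mono h))]
    exact hS.sub_le y x h

theorem lipschitz : LipschitzWith 1 S :=
  LipschitzWith.of_dist_le_mul fun x y => by simpa [Real.dist_eq] using hS.abs_sub_le x y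

theorem continuous : Continuous S := hS.lipschitz.continuous

theorem deriv_nonneg (x : ℝ) : 0 ≤ deriv S x := hS.mono.deriv_nonneg

theorem deriv_le_one (x : ℝ) : deriv S x ≤ 1 := by
  have := norm_deriv_le_of_lipschitz hS.lipschitz (x₀ := x)
  exact (le_abs_self _).trans (by simpa using this)

theorem ae_hasDerivAt : ∀ᵐ x, HasDerivAt S (deriv S x) x :=
  hS.lipschitz.ae_differentiableAt.mono fun _ h => h.hasDerivAt

theorem ac (a b : ℝ) : AbsolutelyContinuousOnInterval S a b :=
  hS.lipschitz.lipschitzOnWith.absolutelyContinuousOnInterval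

theorem ac_sin (a b c : ℝ) : AbsolutelyContinuousOnInterval (fun x => Real.sin (c - S x)) a b := by
  have : LipschitzWith 1 (fun x => Real.sin (c - S x)) := by
    have := Real.lipschitzWith_sin.comp ((LipschitzWith.const c).sub hS.lipschitz)
    simpa using! this
  exact this.lipschitzOnWith.absolutelyContinuousOnInterval

theorem ac_cos (a b c : ℝ) : AbsolutelyContinuousOnInterval (fun x => Real.cos (c - S x)) a b := by
  have : LipschitzWith 1 (fun x => Real.cos (c - S x)) := by
    have := Real.lipschitzWith_cos.comp ((LipschitzWith.const c).sub hS.lipschitz)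
    simpa using! this
  exact this.lipschitzOnWith.absolutelyContinuousOnInterval

theorem intervalIntegrable_mul {g : ℝ → ℝ} (hg : Continuous g) (a b : ℝ) :
    IntervalIntegrable (fun x => deriv S x * g x) volume a b :=
  (hS.ac a b).intervalIntegrable_deriv.mul_continuousOn hg.continuousOn

theorem integral_deriv (a b : ℝ) : ∫ x in a..b, deriv S x = S b - S a :=
  (hS.ac a b).integral_deriv_eq_sub

theorem ac_integral_mul {g : ℝ → ℝ} (hg : Continuous g) (c a b : ℝ) :
    AbsolutelyContinuousOnInterval (fun x => ∫ t in c..x, deriv S t * g t) a b := by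
  have h := (hS.intervalIntegrable_mul hg (min c (min a b))
    (max c (max a b))).absolutelyContinuousOnInterval_intervalIntegral (c := c) (by
      rw [uIcc_of_le (by simp)]; constructor <;> simp)
  refine h.mono ?_
  rw [uIcc_of_le (a := min c (min a b)) (by simp)]
  exact Icc_subset_Icc (by simp) (by simp)

theorem ae_hasDerivAt_integral_mul {g : ℝ → ℝ} (hg : Continuous g) (c : ℝ) :
    ∀ᵐ x, HasDerivAt (fun x => ∫ t in c..x, deriv S t * g t) (deriv S x * g x) x := by
  have hloc : LocallyIntegrable (fun t => deriv S t * g t) volume := by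
    rw [locallyIntegrable_iff]
    intro k hk
    obtain ⟨r, hr⟩ := hk.isBounded.subset_closedBall 0
    rw [Real.closedBall_eq_Icc] at hr
    rcases le_total (0 - r) (0 + r) with h | h
    · exact (((intervalIntegrable_iff_integrableOn_Icc_of_le h).1
        (hS.intervalIntegrable_mul hg _ _))).mono_set hr
    · exact ((intervalIntegrable_iff_integrableOn_Icc_of_le (by linarith [abs_nonneg r])).1
        (hS.intervalIntegrable_mul hg (0 - |r|) (0 + |r|))).mono_set
        (hr.trans (Icc_subset_Icc (by linarith [le_abs_self r]) (by linarith [le_abs_self r])))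
  filter_upwards [LocallyIntegrable.ae_hasDerivAt_integral (hf := hloc)] with x hx using hx c

theorem continuous_integral_mul {g : ℝ → ℝ} (hg : Continuous g) (c : ℝ) :
    Continuous (fun x => ∫ t in c..x, deriv S t * g t) :=
  intervalIntegral.continuous_primitive (fun a b => hS.intervalIntegrable_mul hg a b) c

theorem integral_mul_sin (a b c : ℝ) :
    ∫ x in a..b, deriv S x * Real.sin (c - S x) = Real.cos (c - S b) - Real.cos (c - S a) := by
  apply (hS.ac_cos a b c).integral_eq_sub_of_ae
  filter_upwards [hS.ae_hasDerivAt] with x hx _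
  exact ((hx.const_sub c).cos).congr_deriv (by ring)

theorem integral_mul_cos (a b c : ℝ) :
    ∫ x in a..b, deriv S x * Real.cos (c - S x) = -Real.sin (c - S b) + Real.sin (c - S a) := by
  have := (hS.ac_sin a b c).neg.integral_eq_sub_of_ae
    (g := fun x => deriv S x * Real.cos (c - S x)) (by
      filter_upwards [hS.ae_hasDerivAt] with x hx _
      exact ((hx.const_sub c).sin.neg).congr_deriv (by ring))
  rw [this]
  simp

end IsArcLength

open Real

/-- The secant inequality for the sine, with defect bounded by `g = π - l`. -/
theorem sin_secant_le {l y d : ℝ} (hy : 0 ≤ y) (hyl : y ≤ l) (hl : l < π) (hd : 0 ≤ d)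
    (hdl : d ≤ π - l) :
    0 ≤ (π - l) * sin (y + d) - (π - l) * sin y - d * (sin (l - y) - sin y) := by
  have hg : 0 < π - l := by linarith
  have h := strictConcaveOn_sin_Icc.concaveOn.2 (show y ∈ Icc 0 π from ⟨hy, by linarith⟩)
    (show y + (π - l) ∈ Icc 0 π from ⟨by linarith, by linarith⟩)
    (show 0 ≤ 1 - d / (π - l) by rw [sub_nonneg, div_le_one hg]; exact hdl)
    (show 0 ≤ d / (π - l) by positivity) (by ring)
  have e1 : sin (y + (π - l)) = sin (l - y) := by
    rw [← sin_pi_sub]; ring_nf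
  have e2 : (1 - d / (π - l)) • y + (d / (π - l)) • (y + (π - l)) = y + d := by
    simp only [smul_eq_mul]; field_simp; ring
  rw [e1, e2, smul_eq_mul, smul_eq_mul] at h
  have h2 := mul_le_mul_of_nonneg_left h hg.le
  have e3 : (π - l) * ((1 - d / (π - l)) * sin y + d / (π - l) * sin (l - y)) =
    (π - l) * sin y + d * (sin (l - y) - sin y) := by field_simp; ring
  linarith

theorem sin_secant_lt {l y d : ℝ} (hy : 0 ≤ y) (hyl : y ≤ l) (hl : l < π) (hd : 0 < d)
    (hdl : d < π - l) :
    0 < (π - l) * sin (y + d) - (π - l) * sin y - d * (sin (l - y) - sin y) := by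
  have hg : 0 < π - l := by linarith
  have h := strictConcaveOn_sin_Icc.2 (show y ∈ Icc 0 π from ⟨hy, by linarith⟩)
    (show y + (π - l) ∈ Icc 0 π from ⟨by linarith, by linarith⟩) (by linarith)
    (show 0 < 1 - d / (π - l) by rw [sub_pos, div_lt_one hg]; exact hdl)
    (show 0 < d / (π - l) by positivity) (by ring)
  have e1 : sin (y + (π - l)) = sin (l - y) := by
    rw [← sin_pi_sub]; ring_nf
  have e2 : (1 - d / (π - l)) • y + (d / (π - l)) • (y + (π - l)) = y + d := by
    simp only [smul_eq_mul]; field_simp; ring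
  rw [e1, e2, smul_eq_mul, smul_eq_mul] at h
  have h2 := mul_lt_mul_of_pos_left h hg
  have e3 : (π - l) * ((1 - d / (π - l)) * sin y + d / (π - l) * sin (l - y)) =
    (π - l) * sin y + d * (sin (l - y) - sin y) := by field_simp; ring
  linarith

/-- Twice the area between the curve with radius of curvature `S'` and its chord. -/
noncomputable def arcInner (S : ℝ → ℝ) (a θ : ℝ) : ℝ :=
  sin θ * (∫ t in a..θ, deriv S t * cos t) - cos θ * ∫ t in a..θ, deriv S t * sin t

noncomputable def arcArea (S : ℝ → ℝ) (a b : ℝ) : ℝ :=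
  ∫ θ in a..b, deriv S θ * arcInner S a θ

/-- The integrand of the reverse isoperimetric deficit. -/
noncomputable def arcKernel (S : ℝ → ℝ) (l τ θ : ℝ) : ℝ :=
  (π - l) * sin (θ - τ) - (π - l) * sin (S θ - S τ) -
    ((θ - S θ) - (τ - S τ)) * (sin (l - (S θ - S τ)) - sin (S θ - S τ))

namespace IsArcLength

variable {S : ℝ → ℝ} (hS : IsArcLength S)
include hS

theorem continuous_arcInner (a : ℝ) : Continuous (arcInner S a) := by
  unfold arcInner
  exact (continuous_sin.mul (hS.continuous_integral_mul continuous_cos a)).sub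
    (continuous_cos.mul (hS.continuous_integral_mul continuous_sin a))

theorem continuous_arcKernel (l : ℝ) : Continuous fun p : ℝ × ℝ => arcKernel S l p.1 p.2 := by
  have := hS.continuous
  unfold arcKernel
  fun_prop

theorem arcKernel_nonneg {a b : ℝ} (hb : S b - S a < π) (hab : b = a + π) {τ θ : ℝ} (h1 : a ≤ τ)
    (h2 : τ ≤ θ) (h3 : θ ≤ b) : 0 ≤ arcKernel S (S b - S a) τ θ := by
  have := hS.mono h1
  have := hS.mono h2
  have := hS.mono h3
  have := hS.sub_le _ _ h1
  have := hS.sub_le _ _ h2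
  have := hS.sub_le _ _ h3
  have := sin_secant_le (l := S b - S a) (y := S θ - S τ) (d := (θ - S θ) - (τ - S τ))
    (by linarith) (by linarith) hb (by linarith) (by linarith)
  unfold arcKernel
  convert this using 5
  ring

theorem arcKernel_pos {a b : ℝ} (hb : S b - S a < π) {τ θ : ℝ} (h1 : a ≤ τ)
    (h2 : τ ≤ θ) (h3 : θ ≤ b) (h4 : τ - S τ < θ - S θ)
    (h5 : (θ - S θ) - (τ - S τ) < π - (S b - S a)) : 0 < arcKernel S (S b - S a) τ θ := by
  have := hS.mono h1
  have := hS.mono h2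
  have := hS.mono h3
  have := sin_secant_lt (l := S b - S a) (y := S θ - S τ) (d := (θ - S θ) - (τ - S τ))
    (by linarith) (by linarith) hb (by linarith) (by linarith)
  unfold arcKernel
  convert this using 5
  ring

theorem integral_mul_nonneg {f : ℝ → ℝ} {a b : ℝ} (hab : a ≤ b)
    (h : ∀ x ∈ Icc a b, 0 ≤ f x) : 0 ≤ ∫ x in a..b, deriv S x * f x :=
  intervalIntegral.integral_nonneg hab fun x hx => mul_nonneg (hS.deriv_nonneg x) (h x hx)

theorem integral_mul_ge {f : ℝ → ℝ} (hf : Continuous f) {a b p q c : ℝ} (hap : a ≤ p)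
    (hpq : p ≤ q) (hqb : q ≤ b) (h : ∀ x ∈ Icc a b, 0 ≤ f x) (hc : ∀ x ∈ Icc p q, c ≤ f x) :
    (S q - S p) * c ≤ ∫ x in a..b, deriv S x * f x := by
  have hi := hS.intervalIntegrable_mul hf
  rw [← intervalIntegral.integral_add_adjacent_intervals (hi a p) (hi p b),
    ← intervalIntegral.integral_add_adjacent_intervals (hi p q) (hi q b)]
  have h1 := hS.integral_mul_nonneg hap fun x hx => h x ⟨hx.1, by linarith [hx.2]⟩
  have h2 := hS.integral_mul_nonneg hqb fun x hx => h x ⟨by linarith [hx.1], hx.2⟩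
  have h3 : ∫ x in p..q, deriv S x * c ≤ ∫ x in p..q, deriv S x * f x := by
    apply intervalIntegral.integral_mono_on hpq (hS.intervalIntegrable_mul continuous_const _ _)
      (hi p q)
    intro x hx
    exact mul_le_mul_of_nonneg_left (hc x hx) (hS.deriv_nonneg x)
  rw [intervalIntegral.integral_mul_const, hS.integral_deriv] at h3
  linarith

/-- The inner integral of the kernel. -/
theorem integral_arcKernel (a : ℝ) (h0 : S a = 0) (l θ : ℝ) :
    ∫ τ in a..θ, deriv S τ * arcKernel S l τ θ =
      (π - l) * arcInner S a θ - (π - l) * (1 - cos (S θ))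
      + (-(θ - S θ) * ((cos (l - S θ) + cos (S θ)) - (1 + cos l))
        + (sin (l - S θ) - sin (S θ)) * (∫ τ in a..θ, deriv S τ * ((τ - S τ) * cos (S τ)))
        + (cos (l - S θ) + cos (S θ)) * (∫ τ in a..θ, deriv S τ * ((τ - S τ) * sin (S τ)))) := by
  have hSc := hS.continuous
  have i1 := hS.intervalIntegrable_mul continuous_cos a θ
  have i2 := hS.intervalIntegrable_mul continuous_sin a θ
  have i3 := hS.intervalIntegrable_mul (g := fun τ => sin (S θ - S τ)) (by fun_prop) a θ
  have i4 := hS.intervalIntegrable_mul (g := fun τ => sin ((S θ - l) - S τ)) (by fun_prop) a θ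
  have i5 := hS.intervalIntegrable_mul (g := fun τ => (τ - S τ) * cos (S τ)) (by fun_prop) a θ
  have i6 := hS.intervalIntegrable_mul (g := fun τ => (τ - S τ) * sin (S τ)) (by fun_prop) a θ
  have j1 := i1.const_mul ((π - l) * sin θ)
  have j2 := i2.const_mul ((π - l) * cos θ)
  have j3 := i3.const_mul ((π - l) - (θ - S θ))
  have j4 := i4.const_mul (θ - S θ)
  have j5 := i5.const_mul (sin (l - S θ) - sin (S θ))
  have j6 := i6.const_mul (cos (l - S θ) + cos (S θ))
  have e3 := hS.integral_mul_sin a θ (S θ)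
  have e4 := hS.integral_mul_sin a θ (S θ - l)
  have key : ∀ τ, deriv S τ * arcKernel S l τ θ =
      (π - l) * sin θ * (deriv S τ * cos τ) - (π - l) * cos θ * (deriv S τ * sin τ)
      - ((π - l) - (θ - S θ)) * (deriv S τ * sin (S θ - S τ))
      + (θ - S θ) * (deriv S τ * sin ((S θ - l) - S τ))
      + (sin (l - S θ) - sin (S θ)) * (deriv S τ * ((τ - S τ) * cos (S τ)))
      + (cos (l - S θ) + cos (S θ)) * (deriv S τ * ((τ - S τ) * sin (S τ))) := by
    intro τ
    unfold arcKernel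
    simp only [sin_sub, cos_sub]
    ring
  simp_rw [key]
  rw [intervalIntegral.integral_add, intervalIntegral.integral_add, intervalIntegral.integral_add,
    intervalIntegral.integral_sub, intervalIntegral.integral_sub]
  · simp only [intervalIntegral.integral_const_mul]
    rw [e3, e4, h0]
    unfold arcInner
    have : cos (S θ - l - S θ) = cos l := by rw [← cos_neg]; ring_nf
    rw [this, sub_self, sub_zero, sub_zero, cos_zero, ← cos_neg (S θ - l), neg_sub]
    ring
  all_goals first
    | exact j1 | exact j2 | exact j3 | exact j4 | exact j5 | exact j6
    | exact j1.sub j2 | exact (j1.sub j2).sub j3 | exact ((j1.sub j2).sub j3).add j4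
    | exact (((j1.sub j2).sub j3).add j4).add j5

theorem integral_arcKernel_remainder (a b : ℝ) :
    ∫ θ in a..b, deriv S θ *
      (-(θ - S θ) * ((cos (S b - S θ) + cos (S θ)) - (1 + cos (S b)))
        + (sin (S b - S θ) - sin (S θ)) * (∫ τ in a..θ, deriv S τ * ((τ - S τ) * cos (S τ)))
        + (cos (S b - S θ) + cos (S θ)) * (∫ τ in a..θ, deriv S τ * ((τ - S τ) * sin (S τ)))) =
      0 := by
  have hSc := hS.continuous
  have gC : Continuous fun τ => (τ - S τ) * cos (S τ) := by fun_prop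
  have gD : Continuous fun τ => (τ - S τ) * sin (S τ) := by fun_prop
  have aC := hS.ac_integral_mul gC a a b
  have aD := hS.ac_integral_mul gD a a b
  have dC := hS.ae_hasDerivAt_integral_mul gC a
  have dD := hS.ae_hasDerivAt_integral_mul gD a
  set C := fun θ => ∫ τ in a..θ, deriv S τ * ((τ - S τ) * cos (S τ)) with hC
  set D := fun θ => ∫ τ in a..θ, deriv S τ * ((τ - S τ) * sin (S τ)) with hD
  have l0 : ∀ c : ℝ, AbsolutelyContinuousOnInterval (fun _ => c) a b := fun c =>
    (LipschitzWith.const c).lipschitzOnWith.absolutelyContinuousOnInterval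
  have c0 := hS.ac_cos a b 0
  have s0 := hS.ac_sin a b 0
  have c1 := hS.ac_cos a b (S b)
  have s1 := hS.ac_sin a b (S b)
  have hW := ((((c1.add c0).fun_mul aC).sub ((s1.add s0).fun_mul aD)).sub
    ((l0 (1 + cos (S b))).fun_mul aC)).sub ((l0 (sin (S b))).fun_mul aD)
  have hW' := hW.integral_eq_sub_of_ae (g := fun θ => deriv S θ *
      (-(θ - S θ) * ((cos (S b - S θ) + cos (S θ)) - (1 + cos (S b)))
        + (sin (S b - S θ) - sin (S θ)) * C θ
        + (cos (S b - S θ) + cos (S θ)) * D θ)) (by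
    filter_upwards [hS.ae_hasDerivAt, dC, dD] with x hx hx1 hx2 _
    have q0 := hx.const_sub 0
    have q1 := hx.const_sub (S b)
    refine ((((q1.cos.add q0.cos).mul hx1).sub ((q1.sin.add q0.sin).mul hx2)).sub
      (hx1.const_mul (1 + cos (S b)))).sub (hx2.const_mul (sin (S b))) |>.congr_deriv ?_
    simp only [zero_sub, sin_neg, cos_neg, Pi.add_apply, sin_sub, cos_sub]
    have := sin_sq_add_cos_sq (S x)
    linear_combination (deriv S x * (x - S x) * (1 + cos (S b))) * this)
  refine hW'.trans ?_
  have hCa : C a = 0 := by simp [hC]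
  have hDa : D a = 0 := by simp [hD]
  simp [hCa, hDa]

end IsArcLength

theorem arcArea_sub_const (S : ℝ → ℝ) (c a b : ℝ) : arcArea (fun x => S x - c) a b = arcArea S a b := by
  have : deriv (fun x => S x - c) = deriv S := by ext; simp
  simp [arcArea, arcInner, this]

namespace IsArcLength

variable {S : ℝ → ℝ} (hS : IsArcLength S)
include hS

theorem sub_const (c : ℝ) : IsArcLength fun x => S x - c where
  mono _ _ h := sub_le_sub_right (hS.mono h) c
  sub_le x y h := by have := hS.sub_le x y h; linarith

theorem integral_arcKernel_eq (a b : ℝ) (h0 : S a = 0) :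
    ∫ θ in a..b, deriv S θ * ∫ τ in a..θ, deriv S τ * arcKernel S (S b) τ θ =
      (π - S b) * (arcArea S a b - (S b - sin (S b))) := by
  have hSc := hS.continuous
  have gC : Continuous fun τ => (τ - S τ) * cos (S τ) := by fun_prop
  have gD : Continuous fun τ => (τ - S τ) * sin (S τ) := by fun_prop
  have cC := hS.continuous_integral_mul gC a
  have cD := hS.continuous_integral_mul gD a
  have cI := hS.continuous_arcInner a
  simp_rw [hS.integral_arcKernel a h0]
  have j1 := (hS.intervalIntegrable_mul cI a b).const_mul (π - S b)
  have e2 := hS.integral_mul_sin a b 0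
  have j2 := (hS.intervalIntegrable_mul (g := fun θ => 1 - cos (S θ)) (by fun_prop) a b).const_mul
    (π - S b)
  have j3 := hS.intervalIntegrable_mul (g := fun θ =>
      (-(θ - S θ) * ((cos (S b - S θ) + cos (S θ)) - (1 + cos (S b)))
        + (sin (S b - S θ) - sin (S θ)) * (∫ τ in a..θ, deriv S τ * ((τ - S τ) * cos (S τ)))
        + (cos (S b - S θ) + cos (S θ)) * (∫ τ in a..θ, deriv S τ * ((τ - S τ) * sin (S τ)))))
    (by fun_prop) a b
  have key : ∀ θ, deriv S θ * ((π - S b) * arcInner S a θ - (π - S b) * (1 - cos (S θ))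
      + (-(θ - S θ) * ((cos (S b - S θ) + cos (S θ)) - (1 + cos (S b)))
        + (sin (S b - S θ) - sin (S θ)) * (∫ τ in a..θ, deriv S τ * ((τ - S τ) * cos (S τ)))
        + (cos (S b - S θ) + cos (S θ)) * (∫ τ in a..θ, deriv S τ * ((τ - S τ) * sin (S τ))))) =
      (π - S b) * (deriv S θ * arcInner S a θ) - (π - S b) * (deriv S θ * (1 - cos (S θ))) +
      deriv S θ * (-(θ - S θ) * ((cos (S b - S θ) + cos (S θ)) - (1 + cos (S b)))
        + (sin (S b - S θ) - sin (S θ)) * (∫ τ in a..θ, deriv S τ * ((τ - S τ) * cos (S τ)))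
        + (cos (S b - S θ) + cos (S θ)) * (∫ τ in a..θ, deriv S τ * ((τ - S τ) * sin (S τ)))) :=
    fun θ => by ring
  simp_rw [key]
  rw [intervalIntegral.integral_add, intervalIntegral.integral_sub,
    hS.integral_arcKernel_remainder, intervalIntegral.integral_const_mul,
    intervalIntegral.integral_const_mul]
  · have e3 : ∫ θ in a..b, deriv S θ * (1 - cos (S θ)) = S b - sin (S b) := by
      have := hS.integral_mul_cos a b 0
      simp only [zero_sub, cos_neg, sin_neg, h0, sin_zero, neg_neg, neg_zero, add_zero] at this
      simp_rw [mul_sub, mul_one]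
      rw [intervalIntegral.integral_sub, hS.integral_deriv, this, h0, sub_zero]
      · simpa using hS.intervalIntegrable_mul (g := fun _ => 1) continuous_const a b
      · exact hS.intervalIntegrable_mul (by fun_prop) a b
    rw [e3, arcArea]
    ring
  · exact j1
  · exact j2
  · exact j1.sub j2
  · exact j3

theorem continuous_inner_arcKernel (a l : ℝ) (h0 : S a = 0) :
    Continuous fun θ => ∫ τ in a..θ, deriv S τ * arcKernel S l τ θ := by
  have hSc := hS.continuous
  have gC : Continuous fun τ => (τ - S τ) * cos (S τ) := by fun_prop
  have gD : Continuous fun τ => (τ - S τ) * sin (S τ) := by fun_prop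
  have cC := hS.continuous_integral_mul gC a
  have cD := hS.continuous_integral_mul gD a
  have cI := hS.continuous_arcInner a
  simp_rw [hS.integral_arcKernel a h0]
  fun_prop

theorem le_pi {a : ℝ} : S (a + π) - S a ≤ π := by
  have := hS.sub_le a (a + π) (by linarith [pi_pos]); linarith

/-- A half arc over an angle `π` encloses with its chord at least the area of a circular arc of
unit radius with the same length. -/
theorem le_arcArea (a : ℝ) :
    (S (a + π) - S a) - sin (S (a + π) - S a) ≤ arcArea S a (a + π) := by
  wlog h0 : S a = 0 generalizing S
  · have := this (hS.sub_const (S a)) (sub_self _)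
    rwa [arcArea_sub_const, sub_self, sub_zero] at this
  rw [h0, sub_zero]
  have hpi := pi_pos
  have hle := hS.le_pi (a := a)
  rw [h0, sub_zero] at hle
  rcases hle.lt_or_eq with hlt | heq
  · have hlt' : S (a + π) - S a < π := by linarith
    have h1 : 0 ≤ (π - S (a + π)) * (arcArea S a (a + π) - (S (a + π) - sin (S (a + π)))) := by
      rw [← hS.integral_arcKernel_eq a _ h0]
      refine hS.integral_mul_nonneg (by linarith) fun θ hθ =>
        hS.integral_mul_nonneg hθ.1 fun τ hτ => ?_
      have := hS.arcKernel_nonneg hlt' rfl hτ.1 hτ.2 hθ.2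
      rwa [h0, sub_zero] at this
    have := nonneg_of_mul_nonneg_right h1 (by linarith)
    linarith
  · have hSx : ∀ x ∈ Icc a (a + π), S x = x - a := by
      intro x hx
      have h1 := hS.sub_le a x hx.1
      have h2 := hS.sub_le x _ hx.2
      linarith
    have h2 : ∀ θ ∈ uIcc a (a + π), deriv S θ * arcInner S a θ =
        deriv S θ * (1 - cos (0 - S θ)) := by
      intro θ hθ
      rw [uIcc_of_le (by linarith)] at hθ
      have e : arcInner S a θ = ∫ τ in a..θ, deriv S τ * sin (S θ - S τ) := by
        rw [arcInner, ← intervalIntegral.integral_const_mul, ← intervalIntegral.integral_const_mul,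
          ← intervalIntegral.integral_sub]
        · apply intervalIntegral.integral_congr
          intro τ hτ
          rw [uIcc_of_le hθ.1] at hτ
          have : S θ - S τ = θ - τ := by
            rw [hSx θ hθ, hSx τ ⟨hτ.1, by linarith [hτ.2, hθ.2]⟩]; ring
          simp only [this, sin_sub]
          ring
        · exact (hS.intervalIntegrable_mul continuous_cos _ _).const_mul _
        · exact (hS.intervalIntegrable_mul continuous_sin _ _).const_mul _
      rw [e, hS.integral_mul_sin, h0]
      simp
    rw [arcArea, intervalIntegral.integral_congr h2]
    simp_rw [mul_sub, mul_one]
    have hSc := hS.continuous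
    rw [intervalIntegral.integral_sub, hS.integral_deriv, hS.integral_mul_cos, h0]
    · simp
    · simpa using hS.intervalIntegrable_mul (g := fun _ => 1) continuous_const a (a + π)
    · exact hS.intervalIntegrable_mul (by fun_prop) _ _

theorem continuous_arcKernel_left (l θ : ℝ) : Continuous fun τ => arcKernel S l τ θ := by
  have := hS.continuous
  unfold arcKernel
  fun_prop

theorem eq_or_eq_of_arcArea_eq {a : ℝ} (hlt : S (a + π) - S a < π)
    (h : arcArea S a (a + π) = (S (a + π) - S a) - sin (S (a + π) - S a))
    {p₁ q₁ p₂ q₂ : ℝ} (h1 : a ≤ p₁) (h2 : p₁ ≤ q₁) (h3 : q₁ ≤ p₂) (h4 : p₂ ≤ q₂) (h5 : q₂ ≤ a + π)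
    (h6 : q₁ - S q₁ < p₂ - S p₂) (h7 : (q₂ - S q₂) - (p₁ - S p₁) < π - (S (a + π) - S a)) :
    S p₁ = S q₁ ∨ S p₂ = S q₂ := by
  wlog h0 : S a = 0 generalizing S
  · have := this (hS.sub_const (S a)) (by simpa using hlt)
      (by rw [arcArea_sub_const, h]; simp) (by linarith) (by linarith) (sub_self _)
    simpa using this
  have hint := hS.integral_arcKernel_eq a (a + π) h0
  rw [h, h0, sub_zero, sub_self, mul_zero] at hint
  obtain ⟨x, hx, hmin⟩ := (isCompact_Icc.prod isCompact_Icc :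
    IsCompact (Icc p₁ q₁ ×ˢ Icc p₂ q₂)).exists_isMinOn
      ⟨(p₁, p₂), ⟨⟨le_rfl, h2⟩, ⟨le_rfl, h4⟩⟩⟩
      (f := fun p : ℝ × ℝ => arcKernel S (S (a + π)) p.1 p.2)
      (hS.continuous_arcKernel (S (a + π))).continuousOn
  have hmin' : ∀ τ ∈ Icc p₁ q₁, ∀ θ ∈ Icc p₂ q₂,
      arcKernel S (S (a + π)) x.1 x.2 ≤ arcKernel S (S (a + π)) τ θ :=
    fun τ hτ θ hθ => isMinOn_iff.1 hmin (τ, θ) ⟨hτ, hθ⟩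
  clear hmin
  have hnn : ∀ τ θ, a ≤ τ → τ ≤ θ → θ ≤ a + π → 0 ≤ arcKernel S (S (a + π)) τ θ := by
    intro τ θ u1 u2 u3
    have := hS.arcKernel_nonneg hlt rfl u1 u2 u3
    rwa [h0, sub_zero] at this
  have hpos : 0 < arcKernel S (S (a + π)) x.1 x.2 := by
    obtain ⟨⟨x1, x2⟩, x3, x4⟩ := hx
    have g1 := hS.sub_le _ _ x1
    have g2 := hS.sub_le _ _ x2
    have g3 := hS.sub_le _ _ x3
    have g4 := hS.sub_le _ _ x4
    have := hS.arcKernel_pos hlt (h1.trans x1) (by linarith) (x4.trans h5)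
      (by linarith) (by linarith)
    rwa [h0, sub_zero] at this
  generalize arcKernel S (S (a + π)) x.1 x.2 = ε at hmin' hpos
  have hA : ∀ θ ∈ Icc a (a + π), 0 ≤ ∫ τ in a..θ, deriv S τ * arcKernel S (S (a + π)) τ θ := by
    intro θ hθ
    exact hS.integral_mul_nonneg (f := fun τ => arcKernel S (S (a + π)) τ θ) hθ.1
      fun τ hτ => hnn _ _ hτ.1 hτ.2 hθ.2
  have hB : ∀ θ ∈ Icc p₂ q₂, (S q₁ - S p₁) * ε ≤
      ∫ τ in a..θ, deriv S τ * arcKernel S (S (a + π)) τ θ := by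
    intro θ hθ
    have hf := hS.continuous_arcKernel_left (S (a + π)) θ
    exact hS.integral_mul_ge hf h1 h2 (h3.trans hθ.1)
      (fun τ hτ => hnn _ _ hτ.1 hτ.2 (hθ.2.trans h5)) fun τ hτ => hmin' τ hτ θ hθ
  have hle := hS.integral_mul_ge (hS.continuous_inner_arcKernel a (S (a + π)) h0)
    (h1.trans (h2.trans h3)) h4 h5 hA hB
  rw [hint] at hle
  by_contra! hne
  have m1 := (hS.mono h2).lt_of_ne hne.1
  have m2 := (hS.mono h4).lt_of_ne hne.2
  have : 0 < (S q₂ - S p₂) * ((S q₁ - S p₁) * ε) :=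
    mul_pos (by linarith) (mul_pos (by linarith) hpos)
  linarith

end IsArcLength

theorem exists_last_eq {f : ℝ → ℝ} (hf : Continuous f) {a b : ℝ} (hab : a ≤ b) :
    ∃ m ∈ Icc a b, f m = f a ∧ ∀ x ∈ Icc a b, f x = f a → x ≤ m := by
  have hc : IsCompact (Icc a b ∩ f ⁻¹' {f a}) :=
    isCompact_Icc.inter_right (isClosed_singleton.preimage hf)
  obtain ⟨m, ⟨hm, hm'⟩, hmax⟩ := hc.exists_isGreatest ⟨a, ⟨le_rfl, hab⟩, rfl⟩
  exact ⟨m, hm, hm', fun x hx hx' => hmax ⟨hx, hx'⟩⟩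

theorem exists_first_eq {f : ℝ → ℝ} (hf : Continuous f) {a b : ℝ} (hab : a ≤ b) :
    ∃ m ∈ Icc a b, f m = f b ∧ ∀ x ∈ Icc a b, f x = f b → m ≤ x := by
  have hc : IsCompact (Icc a b ∩ f ⁻¹' {f b}) :=
    isCompact_Icc.inter_right (isClosed_singleton.preimage hf)
  obtain ⟨m, ⟨hm, hm'⟩, hmax⟩ := hc.exists_isLeast ⟨b, ⟨hab, le_rfl⟩, rfl⟩
  exact ⟨m, hm, hm', fun x hx hx' => hmax ⟨hx, hx'⟩⟩

namespace IsArcLength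

variable {S : ℝ → ℝ} (hS : IsArcLength S)
include hS

theorem gap_mono {x y : ℝ} (h : x ≤ y) : x - S x ≤ y - S y := by
  have := hS.sub_le x y h; linarith

/-- In the equality case of `le_arcArea`, the half arc is either an arc with a gap in the normal
directions inside, or a circular arc of unit radius with gaps at the two ends. -/
theorem gap_of_arcArea_eq {a : ℝ} (hlt : S (a + π) - S a < π)
    (h : arcArea S a (a + π) = (S (a + π) - S a) - sin (S (a + π) - S a)) :
    (∃ m n, m ≤ n ∧ n - m = π - (S (a + π) - S a) ∧ S m = S n) ∨
    ∃ α β, a ≤ α ∧ α ≤ β ∧ β ≤ a + π ∧ S α = S a ∧ S β = S (a + π) ∧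
      β - α = S (a + π) - S a := by
  have hpi := pi_pos
  have hab : a ≤ a + π := by linarith
  have hSc := hS.continuous
  have hGc : Continuous fun x => x - S x := by fun_prop
  obtain ⟨α, hα, hα1, hα2⟩ := exists_last_eq hSc hab
  obtain ⟨β, hβ, hβ1, hβ2⟩ := exists_first_eq hSc hab
  by_cases hl : S a = S (a + π)
  · exact .inl ⟨a, a + π, hab, by rw [hl]; ring, hl⟩
  have hl' : S a < S (a + π) := lt_of_le_of_ne (hS.mono hab) hl
  have hαβ : α < β := by
    by_contra! hle
    have := hS.mono hle
    linarith
  have g1 := hS.gap_mono hαβ.le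
  have g2 := hS.gap_mono hα.1
  have g3 := hS.gap_mono hβ.2
  rcases g1.eq_or_lt with e | e
  · exact .inr ⟨α, β, hα.1, hαβ.le, hβ.2, hα1, hβ1, by linarith⟩
  left
  rcases lt_or_ge ((β - S β) - (α - S α)) (π - (S (a + π) - S a)) with e' | e'
  · exfalso
    obtain ⟨c, hc1, hc2⟩ := exists_between e
    have ev1 : ∀ᶠ q in 𝓝[>] α, q - S q < c := by
      have := hGc.continuousAt (x := α)
      exact (this.eventually_lt_const hc1).filter_mono nhdsWithin_le_nhds
    have ev2 : ∀ᶠ p in 𝓝[<] β, c < p - S p := by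
      have := hGc.continuousAt (x := β)
      exact (this.eventually_const_lt hc2).filter_mono nhdsWithin_le_nhds
    obtain ⟨q, hq, hq1, hq2⟩ := (ev1.and (Ioo_mem_nhdsGT hαβ)).exists
    obtain ⟨p, hp, hp1, hp2⟩ := (ev2.and (Ioo_mem_nhdsLT hαβ)).exists
    have hqp : q ≤ p := by
      by_contra! hlt
      have := hS.gap_mono hlt.le
      linarith
    rcases hS.eq_or_eq_of_arcArea_eq hlt h hα.1 hq1.le hqp hp2.le hβ.2 (hq.trans hp) e' with h' | h'
    · exact absurd (hα2 q ⟨hα.1.trans hq1.le, hq2.le.trans hβ.2⟩ (h' ▸ hα1)) (not_le.2 hq1)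
    · exact absurd (hβ2 p ⟨hα.1.trans hp1.le, hp2.le.trans hβ.2⟩ (h'.trans hβ1)) (not_le.2 hp2)
  · have hαa : α = a := by linarith
    subst hαa
    obtain ⟨m, hm, hm1, hm2⟩ := exists_last_eq hGc hab
    obtain ⟨n, hn, hn1, hn2⟩ := exists_first_eq hGc hab
    have hmn : m < n := by
      by_contra! hle
      have := hS.gap_mono hle
      linarith
    have hconst : ∀ p q, m < p → p < q → q < n → S p = S q := by
      intro p q hmp hpq hqn
      have hGp : α - S α < p - S p := by
        refine lt_of_le_of_ne (hS.gap_mono (hm.1.trans hmp.le)) fun heq => ?_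
        exact absurd (hm2 p ⟨hm.1.trans hmp.le, by linarith [hn.2]⟩ heq.symm) (not_le.2 hmp)
      have hGq : q - S q < (α + π) - S (α + π) := by
        refine lt_of_le_of_ne (hS.gap_mono (by linarith [hn.2])) fun heq => ?_
        exact absurd (hn2 q ⟨by linarith [hm.1], by linarith [hn.2]⟩ heq) (not_le.2 hqn)
      have ev1 : ∀ᶠ q in 𝓝[>] α, q - S q < p - S p := by
        have := hGc.continuousAt (x := α)
        exact (this.eventually_lt_const hGp).filter_mono nhdsWithin_le_nhds
      obtain ⟨r, hr, hr1, hr2⟩ :=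
        (ev1.and (Ioo_mem_nhdsGT (show α < p by linarith [hm.1]))).exists
      rcases hS.eq_or_eq_of_arcArea_eq hlt h le_rfl hr1.le hr2.le hpq.le (by linarith [hn.2]) hr (by linarith) with h' | h'
      · exact absurd (hα2 r ⟨hr1.le, by linarith [hn.2]⟩ h'.symm) (not_le.2 hr1)
      · exact h'
    have hmn' : S m = S n := by
      have t1 : Tendsto (fun t : ℝ => S (n - t) - S (m + t)) (𝓝[>] 0) (𝓝 (S n - S m)) := by
        have : Continuous fun t : ℝ => S (n - t) - S (m + t) := by fun_prop
        simpa using (this.continuousWithinAt (s := Ioi 0) (x := 0)).tendsto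
      have t2 : (fun t : ℝ => S (n - t) - S (m + t)) =ᶠ[𝓝[>] 0] fun _ => 0 := by
        filter_upwards [Ioo_mem_nhdsGT (show 0 < (n - m) / 2 by linarith)] with t ht
        rw [hconst (m + t) (n - t) (by linarith [ht.1]) (by linarith [ht.2]) (by linarith [ht.1]),
          sub_self]
      have := tendsto_nhds_unique (t1.congr' t2) tendsto_const_nhds
      linarith
    exact ⟨m, n, hmn.le, by linarith, hmn'⟩

theorem exists_gap_of_arcArea_eq {a : ℝ}
    (hhalf : S (a + 2 * π) - S (a + π) = S (a + π) - S a)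
    (hper : ∀ x, S (x + 2 * π) = S x + 2 * (S (a + π) - S a))
    (h1 : arcArea S a (a + π) = (S (a + π) - S a) - sin (S (a + π) - S a))
    (h2 : arcArea S (a + π) (a + 2 * π) = (S (a + π) - S a) - sin (S (a + π) - S a)) :
    ∃ m n, m ≤ n ∧ n - m = π - (S (a + π) - S a) ∧ S m = S n := by
  rcases (hS.le_pi (a := a)).lt_or_eq with hlt | heq
  swap
  · exact ⟨a, a, le_rfl, by linarith, rfl⟩
  have e : a + π + π = a + 2 * π := by ring
  rcases hS.gap_of_arcArea_eq hlt h1 with hA | ⟨α, β, u1, u2, u3, u4, u5, u6⟩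
  · exact hA
  have h2' := hS.gap_of_arcArea_eq (a := a + π)
  rw [e, hhalf] at h2'
  rcases h2' hlt h2 with hA | ⟨α', β', v1, v2, v3, v4, v5, v6⟩
  · exact hA
  have key : ∀ m n, π - (S (a + π) - S a) ≤ n - m → S m = S n →
      ∃ m n, m ≤ n ∧ n - m = π - (S (a + π) - S a) ∧ S m = S n := by
    intro m n hmn hSmn
    refine ⟨m, m + (π - (S (a + π) - S a)), by linarith, by ring, le_antisymm
      (hS.mono (by linarith)) ?_⟩
    rw [hSmn]
    exact hS.mono (by linarith)
  rcases le_total (π - (S (a + π) - S a)) (α' - β) with hle | hle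
  · exact key _ _ hle (by rw [u5, v4])
  · refine key β' (α + 2 * π) (by linarith) ?_
    rw [v5, hper, hper, u4]

end IsArcLength

theorem arcArea_two_pi {S : ℝ → ℝ} (hS : IsArcLength S) (a : ℝ)
    (hc : ∫ t in a..(a + 2 * π), deriv S t * cos t = 0)
    (hs : ∫ t in a..(a + 2 * π), deriv S t * sin t = 0) :
    arcArea S a (a + 2 * π) = arcArea S a (a + π) + arcArea S (a + π) (a + 2 * π) := by
  have hi := fun b c => hS.intervalIntegrable_mul continuous_cos b c
  have hj := fun b c => hS.intervalIntegrable_mul continuous_sin b c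
  have cI := hS.continuous_arcInner a
  unfold arcArea
  rw [← intervalIntegral.integral_add_adjacent_intervals
    (hS.intervalIntegrable_mul cI a (a + π)) (hS.intervalIntegrable_mul cI (a + π) (a + 2 * π))]
  congr 1
  have hc' := intervalIntegral.integral_add_adjacent_intervals (hi a (a + π))
    (hi (a + π) (a + 2 * π))
  have hs' := intervalIntegral.integral_add_adjacent_intervals (hj a (a + π))
    (hj (a + π) (a + 2 * π))
  rw [hc] at hc'
  rw [hs] at hs'
  have key : ∀ θ, deriv S θ * arcInner S a θ = deriv S θ * arcInner S (a + π) θ +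
      ((∫ t in a..(a + π), deriv S t * cos t) * (deriv S θ * sin θ) -
      (∫ t in a..(a + π), deriv S t * sin t) * (deriv S θ * cos θ)) := by
    intro θ
    unfold arcInner
    rw [← intervalIntegral.integral_add_adjacent_intervals (hi a (a + π)) (hi (a + π) θ),
      ← intervalIntegral.integral_add_adjacent_intervals (hj a (a + π)) (hj (a + π) θ)]
    ring
  simp_rw [key]
  have k1 := (hj (a + π) (a + 2 * π)).const_mul (∫ t in a..(a + π), deriv S t * cos t)
  have k2 := (hi (a + π) (a + 2 * π)).const_mul (∫ t in a..(a + π), deriv S t * sin t)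
  rw [intervalIntegral.integral_add, intervalIntegral.integral_sub,
    intervalIntegral.integral_const_mul, intervalIntegral.integral_const_mul]
  · have e1 : (∫ t in (a + π)..(a + 2 * π), deriv S t * cos t) =
      -∫ t in a..(a + π), deriv S t * cos t := by linarith
    have e2 : (∫ t in (a + π)..(a + 2 * π), deriv S t * sin t) =
      -∫ t in a..(a + π), deriv S t * sin t := by linarith
    rw [e1, e2]
    ring
  · exact k1
  · exact k2
  · exact hS.intervalIntegrable_mul (hS.continuous_arcInner _) _ _
  · exact k1.sub k2

/-- The reverse isoperimetric inequality in terms of the arc length function. -/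
theorem IsArcLength.le_arcArea_two_pi {S : ℝ → ℝ} (hS : IsArcLength S) {l : ℝ}
    (hper : ∀ x, S (x + 2 * π) = S x + 2 * l)
    (hc : ∀ a, ∫ t in a..(a + 2 * π), deriv S t * cos t = 0)
    (hs : ∀ a, ∫ t in a..(a + 2 * π), deriv S t * sin t = 0) :
    ∃ a, 2 * (l - sin l) ≤ arcArea S a (a + 2 * π) ∧
      (arcArea S a (a + 2 * π) ≤ 2 * (l - sin l) →
        ∃ m n, m ≤ n ∧ n - m = π - l ∧ S m = S n) := by
  have hSc := hS.continuous
  have hcont : Continuous fun x => S (x + π) - S x := by fun_prop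
  have h0 : ∃ a, S (a + π) - S a = l := by
    have hπ : (S (π + π) - S π) + (S (0 + π) - S 0) = 2 * l := by
      have := hper 0
      rw [zero_add, two_mul π] at this
      rw [zero_add]
      linarith
    rcases le_total (S (0 + π) - S 0) l with hle | hle
    · exact mem_range_of_exists_le_of_exists_ge hcont ⟨0, hle⟩ ⟨π, by linarith⟩
    · exact mem_range_of_exists_le_of_exists_ge hcont ⟨π, by linarith⟩ ⟨0, hle⟩
  obtain ⟨a, ha⟩ := h0
  have e : a + π + π = a + 2 * π := by ring
  have hhalf : S (a + 2 * π) - S (a + π) = S (a + π) - S a := by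
    have := hper a; linarith
  have i1 := hS.le_arcArea a
  have i2 := hS.le_arcArea (a + π)
  rw [e, hhalf] at i2
  rw [ha] at i1 i2
  refine ⟨a, ?_, fun h => ?_⟩
  · rw [arcArea_two_pi hS a (hc a) (hs a)]
    linarith
  · rw [arcArea_two_pi hS a (hc a) (hs a)] at h
    have := hS.exists_gap_of_arcArea_eq hhalf (by rw [ha]; exact hper)
      (by rw [ha]; linarith) (by rw [ha]; linarith)
    rwa [ha] at this

/-- The unit vector with angle `θ`. -/
noncomputable def dir (θ : ℝ) : EuclideanSpace ℝ (Fin 2) := !₂[cos θ, sin θ]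

/-- The component of `x` in the direction of angle `θ`. -/
noncomputable def comp (θ : ℝ) (x : EuclideanSpace ℝ (Fin 2)) : ℝ := x 0 * cos θ + x 1 * sin θ

@[simp] theorem dir_zero (θ : ℝ) : dir θ 0 = cos θ := rfl
@[simp] theorem dir_one (θ : ℝ) : dir θ 1 = sin θ := rfl

section
variable (θ φ : ℝ) (x y : EuclideanSpace ℝ (Fin 2))

theorem comp_add : comp θ (x + y) = comp θ x + comp θ y := by simp [comp]; ring
theorem comp_sub : comp θ (x - y) = comp θ x - comp θ y := by simp [comp]; ring
theorem comp_smul (c : ℝ) : comp θ (c • x) = c * comp θ x := by simp [comp]; ring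
theorem comp_dir : comp θ (dir φ) = cos (θ - φ) := by simp [comp, cos_sub]; ring
theorem comp_dir_self : comp θ (dir θ) = 1 := by simp [comp_dir]

theorem norm_sq_eq_add : ‖x‖ ^ 2 = x 0 ^ 2 + x 1 ^ 2 := by
  simp [EuclideanSpace.norm_sq_eq, Fin.sum_univ_two]

theorem comp_sq_add_sq : comp θ x ^ 2 + comp (θ + π / 2) x ^ 2 = ‖x‖ ^ 2 := by
  rw [norm_sq_eq_add, comp, comp, cos_add_pi_div_two, sin_add_pi_div_two]
  linear_combination (x 0 ^ 2 + x 1 ^ 2) * sin_sq_add_cos_sq θ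

theorem comp_eq : comp φ x = comp θ x * cos (φ - θ) + comp (θ + π / 2) x * sin (φ - θ) := by
  rw [comp, comp, comp, cos_add_pi_div_two, sin_add_pi_div_two, cos_sub, sin_sub]
  linear_combination (-(x 0 * cos φ) - x 1 * sin φ) * sin_sq_add_cos_sq θ

theorem comp_le_norm : comp θ x ≤ ‖x‖ := by
  have := comp_sq_add_sq θ x
  nlinarith [norm_nonneg x, sq_nonneg (comp (θ + π / 2) x), sq_nonneg (comp θ x + ‖x‖)]

@[simp] theorem norm_dir : ‖dir θ‖ = 1 := by
  have := norm_sq_eq_add (dir θ)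
  rw [dir_zero, dir_one, cos_sq_add_sin_sq] at this
  nlinarith [norm_nonneg (dir θ)]

theorem exists_eq_norm_smul_dir : ∃ θ, x = ‖x‖ • dir θ := by
  rcases eq_or_ne x 0 with rfl | hx
  · exact ⟨0, by simp⟩
  have hx' : ‖x‖ ≠ 0 := norm_ne_zero_iff.2 hx
  obtain ⟨θ, h1, h2⟩ : ∃ θ, cos θ = x 0 / ‖x‖ ∧ sin θ = x 1 / ‖x‖ := by
    have h : (x 0 / ‖x‖) ^ 2 + (x 1 / ‖x‖) ^ 2 = 1 := by
      field_simp; rw [norm_sq_eq_add]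
    refine ⟨Complex.arg ⟨x 0 / ‖x‖, x 1 / ‖x‖⟩, ?_, ?_⟩
    · rw [Complex.cos_arg]
      · simp [Complex.norm_def, Complex.normSq_mk, ← sq, h]
      · intro h0
        have e1 := congrArg Complex.re h0
        have e2 := congrArg Complex.im h0
        simp only [Complex.zero_re, Complex.zero_im] at e1 e2
        rw [e1, e2] at h
        norm_num at h
    · rw [Complex.sin_arg]
      simp [Complex.norm_def, Complex.normSq_mk, ← sq, h]
  refine ⟨θ, ?_⟩
  ext i
  fin_cases i
  · simp [h1]; field_simp
  · simp [h2]; field_simp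

theorem exists_comp_eq_norm : ∃ θ, comp θ x = ‖x‖ := by
  obtain ⟨θ, h⟩ := exists_eq_norm_smul_dir x
  exact ⟨θ, by conv_lhs => rw [h, comp_smul, comp_dir_self, mul_one]⟩

theorem comp_add_pi : comp (θ + π) x = -comp θ x := by simp [comp]; ring
theorem comp_add_two_pi : comp (θ + 2 * π) x = comp θ x := by simp [comp]

theorem abs_comp_sub_comp_le : |comp φ x - comp θ x| ≤ 2 * ‖x‖ * |φ - θ| := by
  have h0 : |x 0| ≤ ‖x‖ := by simpa using PiLp.norm_apply_le x 0
  have h1 : |x 1| ≤ ‖x‖ := by simpa using PiLp.norm_apply_le x 1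
  have hc : |cos φ - cos θ| ≤ |φ - θ| := by
    simpa [Real.dist_eq] using lipschitzWith_cos.dist_le_mul φ θ
  have hs : |sin φ - sin θ| ≤ |φ - θ| := by
    simpa [Real.dist_eq] using lipschitzWith_sin.dist_le_mul φ θ
  have e : comp φ x - comp θ x = x 0 * (cos φ - cos θ) + x 1 * (sin φ - sin θ) := by
    unfold comp; ring
  calc |comp φ x - comp θ x| ≤ |x 0| * |cos φ - cos θ| + |x 1| * |sin φ - sin θ| := by
        rw [e, ← abs_mul, ← abs_mul]; exact abs_add_le _ _
    _ ≤ ‖x‖ * |φ - θ| + ‖x‖ * |φ - θ| := by gcongr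
    _ = _ := by ring

theorem comp_between {s t r : ℝ} :
    sin (t - s) * comp r x = sin (t - r) * comp s x + sin (r - s) * comp t x := by
  simp only [comp, sin_sub]
  ring

theorem ext_comp (h0 : comp θ x = comp θ y) (h1 : comp (θ + π / 2) x = comp (θ + π / 2) y) :
    x = y := by
  have := comp_sq_add_sq θ (x - y)
  rw [comp_sub, comp_sub, h0, h1] at this
  simp only [sub_self] at this
  rw [← sub_eq_zero, ← norm_eq_zero]
  nlinarith

end

theorem continuous_comp : Continuous fun p : ℝ × EuclideanSpace ℝ (Fin 2) => comp p.1 p.2 := by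
  unfold comp
  fun_prop

@[fun_prop] theorem continuous_comp_angle {X : Type*} [TopologicalSpace X] {f : X → ℝ}
    {g : X → EuclideanSpace ℝ (Fin 2)} (hf : Continuous f) (hg : Continuous g) :
    Continuous fun t => comp (f t) (g t) := continuous_comp.comp (hf.prodMk hg)

theorem hasDerivAt_comp (θ : ℝ) (x : EuclideanSpace ℝ (Fin 2)) :
    HasDerivAt (fun φ => comp φ x) (comp (θ + π / 2) x) θ := by
  unfold comp
  rw [cos_add_pi_div_two, sin_add_pi_div_two]
  exact ((hasDerivAt_cos θ).const_mul _).add ((hasDerivAt_sin θ).const_mul _)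

theorem exists_comp_lt_of_mem_interior {K : Set (EuclideanSpace ℝ (Fin 2))}
    {x : EuclideanSpace ℝ (Fin 2)} (hx : x ∈ interior K) (θ : ℝ) :
    ∃ y ∈ K, comp θ x < comp θ y := by
  obtain ⟨ε, hε, hb⟩ := Metric.mem_nhds_iff.1 (mem_interior_iff_mem_nhds.1 hx)
  refine ⟨x + (ε / 2) • dir θ, hb ?_, ?_⟩
  · rw [Metric.mem_ball, dist_eq_norm, add_sub_cancel_left, norm_smul, norm_dir, mul_one,
      Real.norm_eq_abs, abs_of_pos (by positivity)]
    linarith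
  · rw [comp_add, comp_smul, comp_dir_self]
    linarith

theorem mem_frontier_of_isMax {K : Set (EuclideanSpace ℝ (Fin 2))} {x : EuclideanSpace ℝ (Fin 2)}
    (hx : x ∈ K) {θ : ℝ} (h : ∀ y ∈ K, comp θ y ≤ comp θ x) : x ∈ frontier K := by
  refine ⟨subset_closure hx, fun hi => ?_⟩
  obtain ⟨y, hy, hlt⟩ := exists_comp_lt_of_mem_interior hi θ
  exact absurd (h y hy) (not_le.2 hlt)

theorem exists_isMax_of_mem_frontier {K : Set (EuclideanSpace ℝ (Fin 2))} (hK : Convex ℝ K)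
    (hint : (interior K).Nonempty) {p : EuclideanSpace ℝ (Fin 2)} (hp : p ∈ frontier K) :
    ∃ θ, ∀ y ∈ K, comp θ y ≤ comp θ p := by
  obtain ⟨f, hf⟩ := geometric_hahn_banach_open_point hK.interior isOpen_interior hp.2
  have hle : ∀ y ∈ K, f y ≤ f p := by
    intro y hy
    have hy' : y ∈ closure (interior K) := by
      rw [hK.closure_interior_eq_closure_of_nonempty_interior hint]; exact subset_closure hy
    exact closure_minimal (fun z hz => (hf z hz).le) (isClosed_le f.continuous continuous_const) hy'
  set c : EuclideanSpace ℝ (Fin 2) := !₂[f (EuclideanSpace.single 0 1), f (EuclideanSpace.single 1 1)]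
    with hc
  have hfx : ∀ x, f x = x 0 * c 0 + x 1 * c 1 := by
    intro x
    have : x = x 0 • EuclideanSpace.single 0 1 + x 1 • EuclideanSpace.single 1 1 := by
      ext i; fin_cases i <;> simp
    conv_lhs => rw [this, map_add, map_smul, map_smul]
    simp [hc]
  obtain ⟨θ, hθ⟩ := exists_eq_norm_smul_dir c
  have hfc : ∀ x, f x = ‖c‖ * comp θ x := by
    intro x
    rw [hfx, hθ]
    simp [comp, norm_smul]
    ring
  have hcpos : 0 < ‖c‖ := by
    obtain ⟨z, hz⟩ := hint
    have := hf z hz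
    rw [hfc, hfc] at this
    by_contra! h0
    have h00 : ‖c‖ = 0 := le_antisymm h0 (norm_nonneg _)
    rw [h00, zero_mul, zero_mul] at this
    exact lt_irrefl _ this
  refine ⟨θ, fun y hy => ?_⟩
  have := hle y hy
  rw [hfc, hfc] at this
  exact le_of_mul_le_mul_left this hcpos

theorem IsLambdaConvex.eq_of_isMax {K : Set (EuclideanSpace ℝ (Fin 2))} (hconv : Convex ℝ K)
    (hK : IsLambdaConvex 1 K) {x y : EuclideanSpace ℝ (Fin 2)} (hx : x ∈ K) (hy : y ∈ K) {θ : ℝ}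
    (hmx : ∀ z ∈ K, comp θ z ≤ comp θ x) (hmy : ∀ z ∈ K, comp θ z ≤ comp θ y) : x = y := by
  have hxy : comp θ x = comp θ y := le_antisymm (hmy x hx) (hmx y hy)
  by_contra hne
  have hd : 0 < ‖y - x‖ := norm_pos_iff.2 (sub_ne_zero.2 (Ne.symm hne))
  set c : ℝ → EuclideanSpace ℝ (Fin 2) := fun t => x + t • (y - x) with hc
  have hfr : ∀ t ∈ Icc (0 : ℝ) 1, c t ∈ frontier K := by
    intro t ht
    have hm : c t ∈ K := by
      have := hconv hx hy (sub_nonneg.2 ht.2) ht.1 (by ring)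
      convert this using 1
      simp only [hc]; module
    refine mem_frontier_of_isMax hm (θ := θ) fun z hz => ?_
    have : comp θ (c t) = comp θ x := by
      simp only [hc, comp_add, comp_smul, comp_sub, hxy]; ring
    rw [this]; exact hmx z hz
  obtain ⟨U, hU, z, hz, hUK⟩ := hK (c (1 / 2)) (hfr _ ⟨by norm_num, by norm_num⟩)
  have hcc : Continuous c := by fun_prop
  have ht : Tendsto (fun t : ℝ => c (1 / 2 + t)) (𝓝[>] 0) (𝓝 (c (1 / 2))) := by
    have : Continuous fun t : ℝ => c (1 / 2 + t) := by fun_prop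
    simpa using (this.continuousWithinAt (s := Ioi 0) (x := 0)).tendsto
  have ht' : Tendsto (fun t : ℝ => c (1 / 2 - t)) (𝓝[>] 0) (𝓝 (c (1 / 2))) := by
    have : Continuous fun t : ℝ => c (1 / 2 - t) := by fun_prop
    simpa using (this.continuousWithinAt (s := Ioi 0) (x := 0)).tendsto
  obtain ⟨t, ⟨h1, h2⟩, h3, h4⟩ := ((ht.eventually_mem hU).and (ht'.eventually_mem hU) |>.and
    (Ioo_mem_nhdsGT (show (0 : ℝ) < 1 / 2 by norm_num))).exists
  have b1 := hUK ⟨h1, hfr _ ⟨by linarith, by linarith⟩⟩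
  have b2 := hUK ⟨h2, hfr _ ⟨by linarith, by linarith⟩⟩
  rw [Metric.mem_closedBall, dist_eq_norm, div_one] at b1 b2
  rw [dist_eq_norm, div_one] at hz
  have e1 : c (1 / 2 + t) - z = (c (1 / 2) - z) + t • (y - x) := by simp only [hc]; module
  have e2 : c (1 / 2 - t) - z = (c (1 / 2) - z) - t • (y - x) := by simp only [hc]; module
  have par := parallelogram_law_with_norm ℝ (c (1 / 2) - z) (t • (y - x))
  rw [← e1, ← e2, hz, norm_smul, Real.norm_eq_abs, abs_of_pos h3] at par
  have : 0 < t * ‖y - x‖ := mul_pos h3 hd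
  nlinarith [norm_nonneg (c (1 / 2 + t) - z), norm_nonneg (c (1 / 2 - t) - z)]

theorem eq_of_comp_eq_of_lt {K : Set (EuclideanSpace ℝ (Fin 2))} {γ : ℝ → EuclideanSpace ℝ (Fin 2)}
    (hmax : ∀ θ, ∀ x ∈ K, comp θ x ≤ comp θ (γ θ))
    (huniq : ∀ θ, ∀ x ∈ K, (∀ y ∈ K, comp θ y ≤ comp θ x) → x = γ θ)
    (hmem : ∀ θ, γ θ ∈ K) {s t : ℝ} (h : γ s = γ t) (hst : s < t) (htpi : t < s + π) :
    ∀ r ∈ Icc s t, γ r = γ s := by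
  intro r hr
  refine (huniq r _ (hmem s) fun y hy => ?_).symm
  have hpos : 0 < sin (t - s) := sin_pos_of_pos_of_lt_pi (by linarith) (by linarith)
  refine le_of_mul_le_mul_left ?_ hpos
  rw [comp_between y (s := s) (t := t) (r := r), comp_between (γ s) (s := s) (t := t) (r := r)]
  have h1 : 0 ≤ sin (t - r) := sin_nonneg_of_nonneg_of_le_pi (by linarith [hr.2]) (by linarith [hr.1])
  have h2 : 0 ≤ sin (r - s) := sin_nonneg_of_nonneg_of_le_pi (by linarith [hr.1]) (by linarith [hr.2])
  have h3 := hmax s y hy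
  have h4 := hmax t y hy
  rw [← h] at h4
  exact add_le_add (mul_le_mul_of_nonneg_left h3 h1) (mul_le_mul_of_nonneg_left h4 h2)

theorem continuous_support {K : Set (EuclideanSpace ℝ (Fin 2))} (hKc : IsCompact K)
    {γ : ℝ → EuclideanSpace ℝ (Fin 2)}
    (hmax : ∀ θ, ∀ x ∈ K, comp θ x ≤ comp θ (γ θ))
    (huniq : ∀ θ, ∀ x ∈ K, (∀ y ∈ K, comp θ y ≤ comp θ x) → x = γ θ)
    (hmem : ∀ θ, γ θ ∈ K) : Continuous γ := by
  refine continuous_iff_continuousAt.2 fun θ => ?_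
  refine hKc.tendsto_nhds_of_unique_mapClusterPt (Eventually.of_forall hmem) fun y hy hcl => ?_
  refine huniq θ y hy fun x hx => ?_
  by_contra! hlt
  have hfreq : ∃ᶠ φ in 𝓝 θ, dist (γ φ) y < (comp θ x - comp θ y) / 2 :=
    mapClusterPt_iff_frequently.1 hcl _ (Metric.ball_mem_nhds _ (by linarith))
  have hev : ∀ᶠ φ in 𝓝 θ, (comp θ x - comp θ y) / 2 < comp φ (x - y) := by
    have : Continuous fun φ => comp φ (x - y) := by fun_prop
    refine this.continuousAt.eventually_const_lt ?_
    simp only [comp_sub]; linarith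
  obtain ⟨φ, h1, h2⟩ := (hfreq.and_eventually hev).exists
  have h3 := hmax φ x hx
  have h4 := comp_le_norm φ (γ φ - y)
  rw [← dist_eq_norm] at h4
  rw [comp_sub] at h2 h4
  linarith

theorem hasDerivAt_support {K : Set (EuclideanSpace ℝ (Fin 2))}
    {γ : ℝ → EuclideanSpace ℝ (Fin 2)}
    (hmax : ∀ θ, ∀ x ∈ K, comp θ x ≤ comp θ (γ θ))
    (hmem : ∀ θ, γ θ ∈ K) (hγ : Continuous γ) (θ : ℝ) :
    HasDerivAt (fun φ => comp φ (γ φ)) (comp (θ + π / 2) (γ θ)) θ := by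
  have h1 := hasDerivAt_comp θ (γ θ)
  have h2 : HasDerivAt (fun φ => comp φ (γ φ) - comp φ (γ θ)) 0 θ := by
    rw [hasDerivAt_iff_isLittleO]
    simp only [sub_self, sub_zero, smul_zero]
    refine Asymptotics.isLittleO_iff.2 fun c hc => ?_
    have hev : ∀ᶠ φ in 𝓝 θ, dist (γ φ) (γ θ) < c / 2 :=
      hγ.continuousAt.eventually (Metric.ball_mem_nhds _ (by positivity))
    filter_upwards [hev] with φ hφ
    have a1 := hmax φ _ (hmem θ)
    have a2 := hmax θ _ (hmem φ)
    have a3 := abs_comp_sub_comp_le θ φ (γ φ - γ θ)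
    rw [dist_eq_norm] at hφ
    rw [Real.norm_eq_abs, Real.norm_eq_abs, abs_of_nonneg (by linarith)]
    have a4 := (le_abs_self _).trans a3
    rw [comp_sub, comp_sub] at a4
    have : 2 * ‖γ φ - γ θ‖ * |φ - θ| ≤ c * |φ - θ| := by gcongr; linarith
    linarith
  have := h2.add h1
  refine (this.congr_deriv (by ring)).congr_of_eventuallyEq (Eventually.of_forall fun φ => ?_)
  simp

/-- A planar convex body whose boundary is parametrized by its outer normal angle, the arc length
being a nonexpansive function of the angle. -/
structure ArcParam (K : Set (EuclideanSpace ℝ (Fin 2))) (γ : ℝ → EuclideanSpace ℝ (Fin 2))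
    (S : ℝ → ℝ) (P : ℝ) : Prop where
  compact : IsCompact K
  convex : Convex ℝ K
  interior_nonempty : (interior K).Nonempty
  arc : IsArcLength S
  mem : ∀ θ, γ θ ∈ K
  max : ∀ θ, ∀ x ∈ K, comp θ x ≤ comp θ (γ θ)
  uniq : ∀ θ, ∀ x ∈ K, (∀ y ∈ K, comp θ y ≤ comp θ x) → x = γ θ
  surj : ∀ p ∈ frontier K, ∃ θ, γ θ = p
  per : ∀ θ, γ (θ + 2 * π) = γ θ
  perS : ∀ θ, S (θ + 2 * π) = S θ + P
  int_zero : ∀ a b, γ b 0 - γ a 0 = -∫ t in a..b, deriv S t * sin t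
  int_one : ∀ a b, γ b 1 - γ a 1 = ∫ t in a..b, deriv S t * cos t

theorem barrier_slope_le {A B V₀ V₁ c s : ℝ} (hA : A ≤ 0) (hs : 0 < s) (hc : 0 < c)
    (h : 0 ≤ A * c + B * s) (hV : V₀ ^ 2 + V₁ ^ 2 = 1) (hb : (A + V₀) ^ 2 + (B + V₁) ^ 2 ≤ 1)
    (hne : 0 < A ^ 2 + B ^ 2) : V₁ * c ≤ s := by
  have hB : 0 < B := by
    by_contra! hB
    have h1 : B * s ≤ 0 := mul_nonpos_of_nonpos_of_nonneg hB hs.le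
    have h2 : A * c ≤ 0 := mul_nonpos_of_nonpos_of_nonneg hA hc.le
    have h3 : A = 0 := by
      rcases mul_eq_zero.1 (show A * c = 0 by linarith) with h | h
      · exact h
      · linarith
    have h4 : B = 0 := by
      rcases mul_eq_zero.1 (show B * s = 0 by linarith) with h | h
      · exact h
      · linarith
    simp [h3, h4] at hne
  have hV0 : V₀ ≤ 1 := by nlinarith
  have h1 : B * V₁ ≤ -A := by nlinarith
  have h2 : B * (V₁ * c) ≤ B * s := by nlinarith
  exact le_of_mul_le_mul_left h2 hB

section
variable {K : Set (EuclideanSpace ℝ (Fin 2))} {γ : ℝ → EuclideanSpace ℝ (Fin 2)}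
    (hmax : ∀ θ, ∀ x ∈ K, comp θ x ≤ comp θ (γ θ)) (hmem : ∀ θ, γ θ ∈ K)
include hmax hmem

theorem barrier_eq_dir {θ : ℝ} {z : EuclideanSpace ℝ (Fin 2)} (hz : dist (γ θ) z = 1)
    (hev : ∀ᶠ φ in 𝓝 θ, dist (γ φ) z ≤ 1)
    (hR : ∀ᶠ φ in 𝓝[>] θ, γ φ ≠ γ θ) (hL : ∀ᶠ φ in 𝓝[<] θ, γ φ ≠ γ θ) :
    γ θ - z = dir θ := by
  set v := γ θ - z with hv
  have hV : comp θ v ^ 2 + comp (θ + π / 2) v ^ 2 = 1 := by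
    rw [comp_sq_add_sq, hv, ← dist_eq_norm, hz]; norm_num
  have facts : ∀ φ, dist (γ φ) z ≤ 1 → γ φ ≠ γ θ →
      comp θ (γ φ - γ θ) ≤ 0 ∧
      (comp θ (γ φ - γ θ) + comp θ v) ^ 2 +
        (comp (θ + π / 2) (γ φ - γ θ) + comp (θ + π / 2) v) ^ 2 ≤ 1 ∧
      0 < comp θ (γ φ - γ θ) ^ 2 + comp (θ + π / 2) (γ φ - γ θ) ^ 2 ∧
      0 ≤ comp θ (γ φ - γ θ) * cos (φ - θ) + comp (θ + π / 2) (γ φ - γ θ) * sin (φ - θ) := by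
    intro φ h1 h2
    refine ⟨?_, ?_, ?_, ?_⟩
    · rw [comp_sub]; linarith [hmax θ _ (hmem φ)]
    · rw [← comp_add, ← comp_add, comp_sq_add_sq, hv, sub_add_sub_cancel, ← dist_eq_norm]
      nlinarith [dist_nonneg (x := γ φ) (y := z)]
    · rw [comp_sq_add_sq]
      have := norm_pos_iff.2 (sub_ne_zero.2 h2)
      positivity
    · rw [← comp_eq, comp_sub]; linarith [hmax φ _ (hmem θ)]
  have hpi := pi_pos
  have hcont : Continuous fun φ => comp (θ + π / 2) v * cos (φ - θ) := by fun_prop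
  have hcont' : Continuous fun φ => sin (φ - θ) := by fun_prop
  have r1 : comp (θ + π / 2) v ≤ 0 := by
    have : ∀ᶠ φ in 𝓝[>] θ, comp (θ + π / 2) v * cos (φ - θ) ≤ sin (φ - θ) := by
      filter_upwards [hev.filter_mono nhdsWithin_le_nhds, hR,
        Ioo_mem_nhdsGT (show θ < θ + π / 2 by linarith)] with φ h1 h2 h3
      obtain ⟨f1, f2, f3, f4⟩ := facts φ h1 h2
      exact barrier_slope_le f1 (sin_pos_of_pos_of_lt_pi (by linarith [h3.1]) (by linarith [h3.2]))
        (cos_pos_of_mem_Ioo ⟨by linarith [h3.1], by linarith [h3.2]⟩) f4 hV f2 f3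
    have := le_of_tendsto_of_tendsto (hcont.continuousWithinAt (s := Ioi θ) (x := θ)).tendsto
      (hcont'.continuousWithinAt (s := Ioi θ) (x := θ)).tendsto this
    simpa using this
  have r2 : 0 ≤ comp (θ + π / 2) v := by
    have : ∀ᶠ φ in 𝓝[<] θ, sin (φ - θ) ≤ comp (θ + π / 2) v * cos (φ - θ) := by
      filter_upwards [hev.filter_mono nhdsWithin_le_nhds, hL,
        Ioo_mem_nhdsLT (show θ - π / 2 < θ by linarith)] with φ h1 h2 h3
      obtain ⟨f1, f2, f3, f4⟩ := facts φ h1 h2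
      have hs : 0 < -sin (φ - θ) := by
        rw [neg_pos]
        exact sin_neg_of_neg_of_neg_pi_lt (by linarith [h3.2]) (by linarith [h3.1])
      have hc : 0 < cos (φ - θ) := cos_pos_of_mem_Ioo ⟨by linarith [h3.1], by linarith [h3.2]⟩
      have := barrier_slope_le (V₀ := comp θ v) (B := -comp (θ + π / 2) (γ φ - γ θ)) (V₁ := -comp (θ + π / 2) v)
        f1 hs hc (by linarith) (by rw [neg_sq]; exact hV)
        (by rw [← neg_add, neg_sq]; exact f2) (by rw [neg_sq]; exact f3)
      linarith
    have := le_of_tendsto_of_tendsto (hcont'.continuousWithinAt (s := Iio θ) (x := θ)).tendsto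
      (hcont.continuousWithinAt (s := Iio θ) (x := θ)).tendsto this
    simpa using this
  have hV1 : comp (θ + π / 2) v = 0 := le_antisymm r1 r2
  obtain ⟨φ, h1, h2⟩ := ((hev.filter_mono nhdsWithin_le_nhds).and hR).exists
  obtain ⟨f1, f2, f3, f4⟩ := facts φ h1 h2
  rw [hV1] at hV f2
  have hV0 : comp θ v = 1 := by
    rcases sq_eq_one_iff.1 (show comp θ v ^ 2 = 1 by linarith) with h | h
    · exact h
    · rw [h] at f2
      nlinarith
  refine ext_comp θ _ _ (by rw [hV0, comp_dir_self]) ?_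
  rw [hV1, comp_dir, add_sub_cancel_left, cos_pi_div_two]

end

theorem countable_left_const_not_right {X : Type*} (γ : ℝ → X) :
    {θ | (∃ δ > 0, ∀ r ∈ Icc (θ - δ) θ, γ r = γ θ) ∧
      ¬ ∃ δ > 0, ∀ r ∈ Icc θ (θ + δ), γ r = γ θ}.Countable := by
  set E := {θ | (∃ δ > 0, ∀ r ∈ Icc (θ - δ) θ, γ r = γ θ) ∧
      ¬ ∃ δ > 0, ∀ r ∈ Icc θ (θ + δ), γ r = γ θ} with hE
  have key : ∀ θ ∈ E, ∃ δ > 0, ∀ r ∈ Icc (θ - δ) θ, γ r = γ θ := fun θ h => h.1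
  choose! δ hδ hconst using key
  have hlt : ∀ θ ∈ E, ∀ θ' ∈ E, θ < θ' → Disjoint (Ioo (θ - δ θ) θ) (Ioo (θ' - δ θ') θ') := by
    intro θ h θ' h' hlt
    rw [Set.disjoint_left]
    intro x hx hx'
    refine h.2 ⟨θ' - θ, by linarith, fun r hr => ?_⟩
    rw [hconst θ' h' r ⟨by linarith [hx.2, hx'.1, hr.1], by linarith [hr.2]⟩,
      hconst θ' h' θ ⟨by linarith [hx.2, hx'.1, hr.1], by linarith [hr.2]⟩]
  refine Set.PairwiseDisjoint.countable_of_isOpen (s := fun θ => Ioo (θ - δ θ) θ) ?_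
    (fun _ _ => isOpen_Ioo) (fun θ h => nonempty_Ioo.2 (by linarith [hδ θ h]))
  intro θ h θ' h' hne
  rcases lt_or_gt_of_ne hne with h1 | h1
  · exact hlt θ h θ' h' h1
  · exact (hlt θ' h' θ h h1).symm

section
variable {K : Set (EuclideanSpace ℝ (Fin 2))} {γ : ℝ → EuclideanSpace ℝ (Fin 2)}

theorem support_le_of_barrier (hK : IsLambdaConvex 1 K)
    (hmax : ∀ θ, ∀ x ∈ K, comp θ x ≤ comp θ (γ θ))
    (huniq : ∀ θ, ∀ x ∈ K, (∀ y ∈ K, comp θ y ≤ comp θ x) → x = γ θ)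
    (hmem : ∀ θ, γ θ ∈ K) (hγ : Continuous γ) {x : ℝ}
    (hx : x ∉ {θ | (∃ δ > 0, ∀ r ∈ Icc (θ - δ) θ, γ r = γ θ) ∧
      ¬ ∃ δ > 0, ∀ r ∈ Icc θ (θ + δ), γ r = γ θ}) :
    ∀ᶠ y in 𝓝[>] x, comp y (γ y) ≤ comp y (γ x) + 1 - cos (y - x) := by
  have hpi := pi_pos
  by_cases hr : ∃ δ > 0, ∀ r ∈ Icc x (x + δ), γ r = γ x
  · obtain ⟨δ, hδ, h⟩ := hr
    filter_upwards [Ioo_mem_nhdsGT (show x < x + δ by linarith)] with y hy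
    rw [h y ⟨hy.1.le, hy.2.le⟩]
    linarith [cos_le_one (y - x)]
  have hl : ¬ ∃ δ > 0, ∀ r ∈ Icc (x - δ) x, γ r = γ x := fun h => hx ⟨h, hr⟩
  obtain ⟨U, hU, z, hz, hsub⟩ := hK (γ x) (mem_frontier_of_isMax (hmem x) (hmax x))
  rw [one_div_one] at hz hsub
  have hev : ∀ᶠ φ in 𝓝 x, dist (γ φ) z ≤ 1 := by
    filter_upwards [hγ.tendsto x hU] with φ hφ
    exact hsub ⟨hφ, mem_frontier_of_isMax (hmem φ) (hmax φ)⟩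
  have hR : ∀ᶠ φ in 𝓝[>] x, γ φ ≠ γ x := by
    filter_upwards [Ioo_mem_nhdsGT (show x < x + π by linarith)] with φ hφ h
    refine hr ⟨φ - x, by linarith [hφ.1], fun r h' => ?_⟩
    rw [add_sub_cancel] at h'
    exact eq_of_comp_eq_of_lt hmax huniq hmem h.symm hφ.1 hφ.2 r h'
  have hL : ∀ᶠ φ in 𝓝[<] x, γ φ ≠ γ x := by
    filter_upwards [Ioo_mem_nhdsLT (show x - π < x by linarith)] with φ hφ h
    refine hl ⟨x - φ, by linarith [hφ.2], fun r h' => ?_⟩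
    rw [sub_sub_cancel] at h'
    rw [← h]
    exact eq_of_comp_eq_of_lt hmax huniq hmem h hφ.2 (by linarith [hφ.1]) r h'
  have hd := barrier_eq_dir hmax hmem hz hev hR hL
  filter_upwards [hev.filter_mono nhdsWithin_le_nhds] with y hy
  have h1 : comp y (γ y - z) ≤ 1 := (comp_le_norm _ _).trans (by rwa [← dist_eq_norm])
  have h2 : comp y (γ x - z) = cos (y - x) := by rw [hd, comp_dir]
  rw [comp_sub] at h1 h2
  linarith

theorem isArcLength_support (hK : IsLambdaConvex 1 K)
    (hmax : ∀ θ, ∀ x ∈ K, comp θ x ≤ comp θ (γ θ))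
    (huniq : ∀ θ, ∀ x ∈ K, (∀ y ∈ K, comp θ y ≤ comp θ x) → x = γ θ)
    (hmem : ∀ θ, γ θ ∈ K) (hγ : Continuous γ) :
    IsArcLength fun θ => comp (θ + π / 2) (γ θ) + ∫ t in (0 : ℝ)..θ, comp t (γ t) := by
  have hder := hasDerivAt_support hmax hmem hγ
  have hcont : Continuous fun t => comp t (γ t) := by fun_prop
  have hn : Continuous fun t => comp (t + π / 2) (γ t) := by fun_prop
  constructor
  · refine monotone_deriv_add_integral hder hn countable_empty fun x _ =>
      Eventually.of_forall fun y => ?_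
    simp only [← comp_eq]
    exact hmax y _ (hmem x)
  · intro x y hxy
    have := monotone_deriv_add_integral (m := fun t => 1 - comp t (γ t))
      (n := fun t => -comp (t + π / 2) (γ t)) (fun t => (hder t).const_sub 1) hn.neg
      (countable_left_const_not_right γ) (fun t ht => ?_) hxy
    · simp only at this
      rw [intervalIntegral.integral_sub, intervalIntegral.integral_sub] at this
      · simp only [intervalIntegral.integral_const, smul_eq_mul, mul_one, sub_zero] at this
        linarith
      all_goals first | exact intervalIntegrable_const | exact hcont.intervalIntegrable _ _
    · filter_upwards [support_le_of_barrier hK hmax huniq hmem hγ ht] with y hy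
      have := comp_eq t y (γ t)
      linarith

theorem exists_arcParam (hKc : IsCompact K) (hconv : Convex ℝ K) (hint : (interior K).Nonempty)
    (hK : IsLambdaConvex 1 K) : ∃ γ S P, ArcParam K γ S P := by
  have hex : ∀ θ, ∃ x ∈ K, ∀ y ∈ K, comp θ y ≤ comp θ x := by
    intro θ
    have hc : Continuous fun x => comp θ x := by fun_prop
    exact hKc.exists_isMaxOn (hint.mono interior_subset) hc.continuousOn
  choose γ hmem hmax using hex
  have huniq : ∀ θ, ∀ x ∈ K, (∀ y ∈ K, comp θ y ≤ comp θ x) → x = γ θ := fun θ x hx h =>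
    hK.eq_of_isMax hconv hx (hmem θ) h (hmax θ)
  have hγ := continuous_support hKc hmax huniq hmem
  have hper : ∀ θ, γ (θ + 2 * π) = γ θ := fun θ => (huniq θ _ (hmem _) fun y hy => by
    have := hmax (θ + 2 * π) y hy
    rwa [comp_add_two_pi, comp_add_two_pi] at this)
  have hcont : Continuous fun t => comp t (γ t) := by fun_prop
  have hn : Continuous fun t => comp (t + π / 2) (γ t) := by fun_prop
  have hS := isArcLength_support hK hmax huniq hmem hγ
  set S := fun θ => comp (θ + π / 2) (γ θ) + ∫ t in (0 : ℝ)..θ, comp t (γ t) with hSdef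
  have hder := hasDerivAt_support hmax hmem hγ
  set H := fun θ => ∫ t in (0 : ℝ)..θ, comp t (γ t) with hH
  have hHd : ∀ x, HasDerivAt H (comp x (γ x)) x := fun x =>
    intervalIntegral.integral_hasDerivAt_right (hcont.intervalIntegrable _ _)
      (hcont.stronglyMeasurableAtFilter _ _) hcont.continuousAt
  have hSn : ∀ x, comp (x + π / 2) (γ x) = S x - H x := fun x => by simp [hSdef, hH]
  have hsin : ∀ a b, IntervalIntegrable (fun t => deriv S t * sin t) volume a b :=
    fun a b => hS.intervalIntegrable_mul continuous_sin a b
  have hcos : ∀ a b, IntervalIntegrable (fun t => deriv S t * cos t) volume a b :=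
    fun a b => hS.intervalIntegrable_mul continuous_cos a b
  have hSs : ∀ a b, IntervalIntegrable (fun t => S t * sin t) volume a b := fun a b =>
    (hS.continuous.mul continuous_sin).intervalIntegrable _ _
  have hSc : ∀ a b, IntervalIntegrable (fun t => S t * cos t) volume a b := fun a b =>
    (hS.continuous.mul continuous_cos).intervalIntegrable _ _
  have acs : ∀ a b, AbsolutelyContinuousOnInterval sin a b := fun a b =>
    lipschitzWith_sin.lipschitzOnWith.absolutelyContinuousOnInterval
  have acc : ∀ a b, AbsolutelyContinuousOnInterval cos a b := fun a b =>
    lipschitzWith_cos.lipschitzOnWith.absolutelyContinuousOnInterval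
  have hx0 : ∀ x, γ x 0 = comp x (γ x) * cos x + H x * sin x - S x * sin x := by
    intro x
    have h := hSn x
    rw [comp, cos_add_pi_div_two, sin_add_pi_div_two] at h
    rw [comp]
    linear_combination (-sin x) * h - γ x 0 * sin_sq_add_cos_sq x
  have hx1 : ∀ x, γ x 1 = comp x (γ x) * sin x - H x * cos x + S x * cos x := by
    intro x
    have h := hSn x
    rw [comp, cos_add_pi_div_two, sin_add_pi_div_two] at h
    rw [comp]
    linear_combination (cos x) * h - γ x 1 * sin_sq_add_cos_sq x
  refine ⟨γ, S, ∫ t in (0 : ℝ)..(2 * π), comp t (γ t), hKc, hconv, hint, hS, hmem, hmax, huniq,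
    ?_, hper, ?_, ?_, ?_⟩
  · intro p hp
    obtain ⟨θ, h⟩ := exists_isMax_of_mem_frontier hconv hint hp
    exact ⟨θ, (huniq θ p (hKc.isClosed.frontier_subset hp) h).symm⟩
  · intro θ
    have hp : Function.Periodic (fun t => comp t (γ t)) (2 * π) := fun t => by
      simp only [hper, comp_add_two_pi]
    have h1 := intervalIntegral.integral_add_adjacent_intervals
      (hcont.intervalIntegrable 0 θ (μ := volume)) (hcont.intervalIntegrable θ (θ + 2 * π))
    have h2 := hp.intervalIntegral_add_eq 0 θ
    rw [zero_add] at h2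
    simp only [hSdef, hper, ← h1, h2]
    rw [add_right_comm, comp_add_two_pi, add_assoc]
  · intro a b
    have h1 : ∫ t in a..b, S t * cos t =
        (comp b (γ b) * cos b + H b * sin b) - (comp a (γ a) * cos a + H a * sin a) := by
      refine intervalIntegral.integral_eq_sub_of_hasDerivAt
        (f := fun x => comp x (γ x) * cos x + H x * sin x) (fun x _ => ?_) (hSc a b)
      refine (((hder x).mul (hasDerivAt_cos x)).add ((hHd x).mul (hasDerivAt_sin x))).congr_deriv ?_
      rw [hSn]; ring
    have h2 : ∫ t in a..b, (deriv S t * sin t + S t * cos t) = S b * sin b - S a * sin a := by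
      refine ((hS.ac a b).fun_mul (acs a b)).integral_eq_sub_of_ae ?_
      filter_upwards [hS.ae_hasDerivAt] with x hx _
      exact hx.mul (hasDerivAt_sin x)
    rw [intervalIntegral.integral_add (hsin a b) (hSc a b)] at h2
    rw [hx0, hx0]
    linarith
  · intro a b
    have h1 : ∫ t in a..b, S t * sin t =
        (comp b (γ b) * sin b - H b * cos b) - (comp a (γ a) * sin a - H a * cos a) := by
      refine intervalIntegral.integral_eq_sub_of_hasDerivAt
        (f := fun x => comp x (γ x) * sin x - H x * cos x) (fun x _ => ?_) (hSs a b)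
      refine (((hder x).mul (hasDerivAt_sin x)).sub ((hHd x).mul (hasDerivAt_cos x))).congr_deriv ?_
      rw [hSn]; ring
    have h2 : ∫ t in a..b, (deriv S t * cos t - S t * sin t) = S b * cos b - S a * cos a := by
      refine ((hS.ac a b).fun_mul (acc a b)).integral_eq_sub_of_ae ?_
      filter_upwards [hS.ae_hasDerivAt] with x hx _
      exact (hx.mul (hasDerivAt_cos x)).congr_deriv (by ring)
    rw [intervalIntegral.integral_sub (hcos a b) (hSs a b)] at h2
    rw [hx1, hx1]
    linarith

end

namespace ArcParam
variable {K : Set (EuclideanSpace ℝ (Fin 2))} {γ : ℝ → EuclideanSpace ℝ (Fin 2)}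
    {S : ℝ → ℝ} {P : ℝ} (h : ArcParam K γ S P)
include h

theorem continuous : Continuous γ := continuous_support h.compact h.max h.uniq h.mem

theorem comp_sub_eq (ψ a b : ℝ) :
    comp ψ (γ b) - comp ψ (γ a) = ∫ t in a..b, deriv S t * sin (ψ - t) := by
  have h0 := h.int_zero a b
  have h1 := h.int_one a b
  have : ∫ t in a..b, deriv S t * sin (ψ - t) =
      sin ψ * (∫ t in a..b, deriv S t * cos t) - cos ψ * ∫ t in a..b, deriv S t * sin t := by
    rw [← intervalIntegral.integral_const_mul, ← intervalIntegral.integral_const_mul,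
      ← intervalIntegral.integral_sub]
    · congr 1
      ext t
      rw [sin_sub]
      ring
    · exact (h.arc.intervalIntegrable_mul continuous_cos a b).const_mul _
    · exact (h.arc.intervalIntegrable_mul continuous_sin a b).const_mul _
  rw [this, ← h1, comp, comp]
  linear_combination (cos ψ) * h0

theorem integral_cos_eq_zero (a : ℝ) : ∫ t in a..(a + 2 * π), deriv S t * cos t = 0 := by
  rw [← h.int_one, h.per, sub_self]

theorem integral_sin_eq_zero (a : ℝ) : ∫ t in a..(a + 2 * π), deriv S t * sin t = 0 := by
  have := h.int_zero a (a + 2 * π)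
  rw [h.per, sub_self] at this
  linarith

theorem length_nonneg : 0 ≤ P := by
  have := h.arc.mono (show (0 : ℝ) ≤ 0 + 2 * π by linarith [pi_pos])
  rw [h.perS] at this
  linarith

theorem integrable_sin (ψ a b : ℝ) :
    IntervalIntegrable (fun t => deriv S t * sin (ψ - t)) volume a b :=
  h.arc.intervalIntegrable_mul (by fun_prop) a b

theorem integrable_deriv (a b : ℝ) : IntervalIntegrable (deriv S) volume a b :=
  (h.arc.ac a b).intervalIntegrable_deriv

theorem dist_le (a b : ℝ) : dist (γ a) (γ b) ≤ |S a - S b| := by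
  wlog hab : a ≤ b generalizing a b
  · rw [dist_comm, abs_sub_comm]
    exact this b a (le_of_not_ge hab)
  obtain ⟨ψ, hψ⟩ := exists_comp_eq_norm (γ b - γ a)
  rw [dist_comm, dist_eq_norm, ← hψ, comp_sub, h.comp_sub_eq, abs_sub_comm,
    abs_of_nonneg (sub_nonneg.2 (h.arc.mono hab)), ← h.arc.integral_deriv]
  refine intervalIntegral.integral_mono_on hab (h.integrable_sin ψ a b)
    (h.integrable_deriv a b) fun t _ => ?_
  exact mul_le_of_le_one_right (h.arc.deriv_nonneg t) (sin_le_one _)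

theorem cos_mul_le {s t : ℝ} (hst : s ≤ t) (ht : t - s ≤ 2 * π) :
    cos ((t - s) / 2) * (S t - S s) ≤
      comp ((s + t) / 2 + π / 2) (γ t) - comp ((s + t) / 2 + π / 2) (γ s) := by
  rw [h.comp_sub_eq, ← h.arc.integral_deriv, ← intervalIntegral.integral_const_mul]
  refine intervalIntegral.integral_mono_on hst ((h.integrable_deriv s t).const_mul _)
    (h.integrable_sin _ s t) fun r hr => ?_
  rw [mul_comm]
  refine mul_le_mul_of_nonneg_left ?_ (h.arc.deriv_nonneg r)
  rw [show (s + t) / 2 + π / 2 - r = π / 2 - (r - (s + t) / 2) by ring, sin_pi_div_two_sub,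
    ← cos_abs (r - _)]
  refine cos_le_cos_of_nonneg_of_le_pi (abs_nonneg _) (by linarith) ?_
  rw [abs_le]
  constructor <;> linarith [hr.1, hr.2]

theorem eq_of_arcLength_eq {s t : ℝ} (hst : S s = S t) : γ s = γ t := by
  have := h.dist_le s t
  rw [hst, sub_self, abs_zero] at this
  exact dist_le_zero.1 this

theorem arcLength_eq {s t : ℝ} (hst : s ≤ t) (ht : t < s + π) (heq : γ s = γ t) : S s = S t := by
  have h1 := h.cos_mul_le hst (by linarith [pi_pos])
  rw [heq, sub_self] at h1
  have h2 : 0 < cos ((t - s) / 2) := cos_pos_of_mem_Ioo ⟨by linarith [pi_pos], by linarith⟩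
  have h3 := h.arc.mono hst
  by_contra hne
  have : 0 < S t - S s := sub_pos.2 (lt_of_le_of_ne h3 hne)
  have := mul_pos h2 this
  linarith

theorem add_pi_ne (s : ℝ) : γ (s + π) ≠ γ s := by
  intro heq
  obtain ⟨x, hx⟩ := h.interior_nonempty
  obtain ⟨y, hy, hlt⟩ := exists_comp_lt_of_mem_interior hx s
  have h1 := h.max s y hy
  have h2 := h.max (s + π) x (interior_subset hx)
  rw [comp_add_pi, comp_add_pi, heq] at h2
  linarith

theorem comp_sub_le {ψ θ : ℝ} (h1 : θ - π ≤ ψ) (h2 : ψ ≤ θ + π) :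
    comp ψ (γ ψ) - comp ψ (γ θ) ≤ 1 - cos (ψ - θ) := by
  rw [h.comp_sub_eq]
  rcases le_total θ ψ with hle | hle
  · have : ∫ t in θ..ψ, sin (ψ - t) = 1 - cos (ψ - θ) := by
      simp [intervalIntegral.integral_comp_sub_left (fun t => sin t)]
    rw [← this]
    refine intervalIntegral.integral_mono_on hle (h.integrable_sin _ _ _)
      (Continuous.intervalIntegrable (by fun_prop) _ _) fun t ht => ?_
    exact mul_le_of_le_one_left (sin_nonneg_of_nonneg_of_le_pi (by linarith [ht.2])
      (by linarith [ht.1])) (h.arc.deriv_le_one t)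
  · have : ∫ t in ψ..θ, -sin (ψ - t) = 1 - cos (ψ - θ) := by
      simp [intervalIntegral.integral_comp_sub_left (fun t => sin t)]
    rw [← this, intervalIntegral.integral_symm, ← intervalIntegral.integral_neg]
    refine intervalIntegral.integral_mono_on hle (h.integrable_sin _ _ _).neg
      (Continuous.intervalIntegrable (by fun_prop) _ _) fun t ht => ?_
    rw [← mul_neg, ← sin_neg]
    exact mul_le_of_le_one_left (sin_nonneg_of_nonneg_of_le_pi (by linarith [ht.1])
      (by linarith [ht.2])) (h.arc.deriv_le_one t)

theorem subset_closedBall (θ : ℝ) : K ⊆ Metric.closedBall (γ θ - dir θ) 1 := by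
  intro x hx
  rw [Metric.mem_closedBall, dist_eq_norm]
  obtain ⟨ψ₀, hψ₀⟩ := exists_comp_eq_norm (x - (γ θ - dir θ))
  obtain ⟨ψ, hψ, hmem⟩ : ∃ ψ, comp ψ (x - (γ θ - dir θ)) = ‖x - (γ θ - dir θ)‖ ∧
      ψ ∈ Ioc (θ - π) (θ - π + 2 * π) := by
    have hp : Function.Periodic (fun ψ => comp ψ (x - (γ θ - dir θ))) (2 * π) := fun t =>
      comp_add_two_pi _ _
    obtain ⟨ψ, h1, h2⟩ := hp.exists_mem_Ioc two_pi_pos ψ₀ (θ - π)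
    exact ⟨ψ, by rw [← hψ₀]; exact h2.symm, h1⟩
  rw [← hψ, comp_sub, comp_sub, comp_dir]
  have h1 := h.comp_sub_le (ψ := ψ) (θ := θ) hmem.1.le (by linarith [hmem.2])
  have h2 := h.max ψ x hx
  linarith

theorem frontier_eq_image (a : ℝ) : frontier K = γ '' Icc a (a + 2 * π) := by
  ext p
  constructor
  · intro hp
    obtain ⟨θ, rfl⟩ := h.surj p hp
    obtain ⟨ψ, h1, h2⟩ := Function.Periodic.exists_mem_Ioc (f := γ) h.per two_pi_pos θ a
    exact ⟨ψ, ⟨h1.1.le, h1.2⟩, h2.symm⟩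
  · rintro ⟨θ, -, rfl⟩
    exact mem_frontier_of_isMax (h.mem θ) (h.max θ)

theorem hausdorffMeasure_frontier_le : μH[1] (frontier K) ≤ ENNReal.ofReal P := by
  set g := γ ∘ Function.invFun S with hg
  have hgS : ∀ θ, g (S θ) = γ θ := fun θ =>
    h.eq_of_arcLength_eq (Function.invFun_eq ⟨θ, rfl⟩)
  have hlip : LipschitzOnWith 1 g (S '' Icc 0 (0 + 2 * π)) := by
    refine LipschitzOnWith.of_dist_le_mul ?_
    rintro _ ⟨s, -, rfl⟩ _ ⟨t, -, rfl⟩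
    rw [hgS, hgS, NNReal.coe_one, one_mul, Real.dist_eq]
    exact h.dist_le s t
  have himg : frontier K = g '' (S '' Icc 0 (0 + 2 * π)) := by
    rw [h.frontier_eq_image 0, image_image]
    simp only [hgS]
  have hsub : S '' Icc 0 (0 + 2 * π) ⊆ Icc (S 0) (S 0 + P) := by
    rintro _ ⟨t, ht, rfl⟩
    exact ⟨h.arc.mono ht.1, by rw [← h.perS]; exact h.arc.mono ht.2⟩
  rw [himg]
  calc μH[1] (g '' (S '' Icc 0 (0 + 2 * π))) ≤ (1 : NNReal) ^ (1 : ℝ) *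
        μH[1] (S '' Icc 0 (0 + 2 * π)) := hlip.hausdorffMeasure_image_le zero_le_one
    _ ≤ μH[1] (Icc (S 0) (S 0 + P)) := by
        simpa using measure_mono (μ := μH[1]) hsub
    _ = ENNReal.ofReal P := by rw [hausdorffMeasure_real, Real.volume_Icc, add_sub_cancel_left]

theorem le_hausdorffMeasure_image {s t : ℝ} (hst : s ≤ t) (ht : t - s ≤ 2 * π) :
    ENNReal.ofReal (cos ((t - s) / 2) * (S t - S s)) ≤ μH[1] (γ '' Icc s t) := by
  set ψ := (s + t) / 2 + π / 2
  have hlip : LipschitzWith 1 (comp ψ) := by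
    refine LipschitzWith.of_le_add fun x y => ?_
    have := comp_le_norm ψ (x - y)
    rw [comp_sub] at this
    rw [dist_eq_norm]
    linarith
  have hc : ContinuousOn (fun r => comp ψ (γ r)) (Icc s t) := by
    have := h.continuous
    exact Continuous.continuousOn (by fun_prop)
  have hsub : Icc (comp ψ (γ s)) (comp ψ (γ t)) ⊆ comp ψ '' (γ '' Icc s t) := by
    rw [image_image]
    exact intermediate_value_Icc hst hc
  calc ENNReal.ofReal (cos ((t - s) / 2) * (S t - S s))
      ≤ ENNReal.ofReal (comp ψ (γ t) - comp ψ (γ s)) :=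
        ENNReal.ofReal_le_ofReal (h.cos_mul_le hst ht)
    _ = μH[1] (Icc (comp ψ (γ s)) (comp ψ (γ t))) := by
        rw [hausdorffMeasure_real, Real.volume_Icc]
    _ ≤ μH[1] (comp ψ '' (γ '' Icc s t)) := measure_mono hsub
    _ ≤ μH[1] (γ '' Icc s t) := by
        simpa using hlip.hausdorffMeasure_image_le (d := 1) zero_le_one (γ '' Icc s t)

theorem const_or_const {s t : ℝ} (hst : s ≤ t) (ht : t ≤ s + 2 * π) (heq : γ s = γ t) :
    (∀ r ∈ Icc s t, γ r = γ s) ∨ ∀ r ∈ Icc t (s + 2 * π), γ r = γ s := by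
  rcases hst.eq_or_lt with rfl | hlt
  · left
    intro r hr
    rw [le_antisymm hr.2 hr.1]
  rcases ht.eq_or_lt with rfl | hlt'
  · right
    intro r hr
    rw [le_antisymm hr.2 hr.1, heq]
  rcases lt_trichotomy t (s + π) with h1 | h1 | h1
  · exact .inl (eq_of_comp_eq_of_lt h.max h.uniq h.mem heq hlt h1)
  · exact absurd (h1 ▸ heq.symm) (h.add_pi_ne s)
  · right
    rw [heq]
    exact eq_of_comp_eq_of_lt h.max h.uniq h.mem (by rw [h.per, heq]) hlt' (by linarith)

theorem le_hausdorffMeasure_frontier_aux {N : ℕ} (hN : 0 < N) :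
    ENNReal.ofReal (cos (π / N) * P) ≤ μH[1] (frontier K) := by
  have hpi := pi_pos
  have hN' : (0 : ℝ) < N := by exact_mod_cast hN
  set δ := 2 * π / N with hδ
  have hδ0 : 0 < δ := by positivity
  have hNδ : N * δ = 2 * π := by rw [hδ]; field_simp
  set F : Set (EuclideanSpace ℝ (Fin 2)) := (fun k : ℕ => γ (k * δ)) '' Iic N with hF
  have := Measure.nullSingletonClass_hausdorff (EuclideanSpace ℝ (Fin 2)) zero_lt_one
  have hF0 : μH[1] F = 0 := ((Set.finite_Iic N).image _).measure_zero _
  set A : ℕ → Set (EuclideanSpace ℝ (Fin 2)) := fun k => γ '' Icc (k * δ) ((k + 1 : ℕ) * δ)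
  have hmeas : ∀ k, MeasurableSet (A k) := fun k =>
    (isCompact_Icc.image h.continuous).measurableSet
  have hdisj : ∀ i < N, ∀ j < N, i < j → Disjoint (A i \ F) (A j \ F) := by
    intro i hi j hj hij
    rw [Set.disjoint_left]
    rintro p ⟨⟨s, hs, rfl⟩, hp⟩ ⟨⟨t, ht, hts⟩, -⟩
    have h1 : ((i + 1 : ℕ) : ℝ) * δ ≤ j * δ :=
      mul_le_mul_of_nonneg_right (by exact_mod_cast hij) hδ0.le
    have h2 : ((j + 1 : ℕ) : ℝ) * δ ≤ N * δ :=
      mul_le_mul_of_nonneg_right (by exact_mod_cast hj) hδ0.le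
    have h0 : 0 ≤ (i : ℝ) * δ := by positivity
    rcases h.const_or_const (by linarith [hs.2, ht.1]) (by linarith [hs.1, ht.2]) hts.symm
      with hc | hc
    · exact hp ⟨i + 1, by simp; omega, hc _ ⟨hs.2, by linarith [ht.1]⟩⟩
    · exact hp ⟨j + 1, by simp; omega, hc _ ⟨ht.2, by linarith [hs.1]⟩⟩
  have hpair : (↑(Finset.range N) : Set ℕ).PairwiseDisjoint fun k => A k \ F := by
    intro i hi j hj hne
    simp only [Finset.coe_range, mem_Iio] at hi hj
    rcases lt_or_gt_of_ne hne with hij | hij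
    · exact hdisj i hi j hj hij
    · exact (hdisj j hj i hi hij).symm
  have hsub : ⋃ k ∈ Finset.range N, A k \ F ⊆ frontier K := by
    refine iUnion₂_subset fun k _ => ?_
    rintro p ⟨⟨s, -, rfl⟩, -⟩
    exact mem_frontier_of_isMax (h.mem s) (h.max s)
  have hsum : ∑ k ∈ Finset.range N, (cos (π / N) * (S ((k + 1 : ℕ) * δ) - S (k * δ))) =
      cos (π / N) * P := by
    rw [← Finset.mul_sum, Finset.sum_range_sub (fun k : ℕ => S (k * δ)), hNδ]
    have := h.perS 0
    rw [zero_add] at this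
    simp [this]
  rcases Nat.lt_or_ge N 2 with hN2 | hN2
  · have : N = 1 := by omega
    subst this
    have : cos (π / (1 : ℕ)) * P ≤ 0 := by
      simpa using h.length_nonneg
    rw [ENNReal.ofReal_eq_zero.2 this]
    exact zero_le
  have hcos : 0 ≤ cos (π / N) := by
    have h2 : (2 : ℝ) ≤ N := by exact_mod_cast hN2
    refine cos_nonneg_of_mem_Icc ⟨by linarith [show 0 < π / N by positivity], ?_⟩
    exact div_le_div_of_nonneg_left hpi.le (by norm_num) h2
  rw [← hsum, ENNReal.ofReal_sum_of_nonneg fun k _ => mul_nonneg hcos (sub_nonneg.2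
    (h.arc.mono (mul_le_mul_of_nonneg_right (by simp) hδ0.le)))]
  calc ∑ k ∈ Finset.range N, ENNReal.ofReal (cos (π / N) * (S ((k + 1 : ℕ) * δ) - S (k * δ)))
      ≤ ∑ k ∈ Finset.range N, μH[1] (A k \ F) := by
        refine Finset.sum_le_sum fun k _ => ?_
        rw [measure_sdiff_null hF0]
        have hk : ((k + 1 : ℕ) : ℝ) * δ - k * δ = δ := by push_cast; ring
        have := h.le_hausdorffMeasure_image (s := k * δ) (t := (k + 1 : ℕ) * δ) (by linarith)
          (by rw [hk, ← hNδ]; nlinarith [show (1 : ℝ) ≤ N by exact_mod_cast hN])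
        rwa [hk, show δ / 2 = π / N by rw [hδ]; ring] at this
    _ = μH[1] (⋃ k ∈ Finset.range N, A k \ F) :=
        (measure_biUnion_finset hpair fun k _ =>
          (hmeas k).diff ((Set.finite_Iic N).image _).measurableSet).symm
    _ ≤ μH[1] (frontier K) := measure_mono hsub

theorem hausdorffMeasure_frontier : μH[1] (frontier K) = ENNReal.ofReal P := by
  refine le_antisymm h.hausdorffMeasure_frontier_le ?_
  have h1 : Tendsto (fun N : ℕ => ENNReal.ofReal (cos (π / N) * P)) atTop
      (𝓝 (ENNReal.ofReal P)) := by
    have h2 : Tendsto (fun N : ℕ => π / (N : ℝ)) atTop (𝓝 0) :=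
      tendsto_const_div_atTop_nhds_zero_nat π
    have h3 := (continuous_cos.tendsto 0).comp h2
    rw [cos_zero] at h3
    have h4 := h3.mul_const P
    rw [one_mul] at h4
    exact (ENNReal.continuous_ofReal.tendsto P).comp h4
  refine le_of_tendsto h1 ?_
  filter_upwards [eventually_gt_atTop 0] with N hN
  exact h.le_hausdorffMeasure_frontier_aux hN

end ArcParam

/-- The coordinates of a point of the Euclidean plane. -/
noncomputable def planeCoord : EuclideanSpace ℝ (Fin 2) ≃ᵐ ℝ × ℝ :=
  (MeasurableEquiv.toLp 2 (Fin 2 → ℝ)).symm.trans MeasurableEquiv.finTwoArrow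

theorem planeCoord_apply (x : EuclideanSpace ℝ (Fin 2)) : planeCoord x = (x 0, x 1) := rfl

theorem volume_planeCoord_image (s : Set (EuclideanSpace ℝ (Fin 2))) :
    volume (planeCoord '' s) = volume s := by
  have h : MeasurePreserving planeCoord :=
    (volume_preserving_finTwoArrow ℝ).comp
      (EuclideanSpace.volume_preserving_symm_measurableEquiv_toLp (Fin 2))
  rw [MeasurableEquiv.image_eq_preimage_symm]
  exact h.symm.measure_preimage_equiv s

section
variable (γ : ℝ → EuclideanSpace ℝ (Fin 2)) (o : EuclideanSpace ℝ (Fin 2))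

/-- Coordinates of the point dividing the segment from `o` to `γ θ` in ratio `r`. -/
noncomputable def coneMap (p : ℝ × ℝ) : ℝ × ℝ :=
  (o 0 + p.1 * (γ p.2 0 - o 0), o 1 + p.1 * (γ p.2 1 - o 1))

theorem coneMap_eq (p : ℝ × ℝ) : coneMap γ o p = planeCoord (o + p.1 • (γ p.2 - o)) := by
  simp [coneMap, planeCoord_apply]

/-- The derivative of `coneMap`, where `u` and `v` are the derivatives of the coordinates. -/
noncomputable def coneDeriv (u v : ℝ → ℝ) (p : ℝ × ℝ) : ℝ × ℝ →L[ℝ] ℝ × ℝ :=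
  (Matrix.toLin (.finTwoProd ℝ) (.finTwoProd ℝ)
    !![γ p.2 0 - o 0, p.1 * u p.2; γ p.2 1 - o 1, p.1 * v p.2]).toContinuousLinearMap

variable {γ o}

theorem det_coneDeriv (u v : ℝ → ℝ) (p : ℝ × ℝ) : (coneDeriv γ o u v p).det =
    p.1 * ((γ p.2 0 - o 0) * v p.2 - (γ p.2 1 - o 1) * u p.2) := by
  unfold coneDeriv
  simp only [LinearMap.det_toContinuousLinearMap, LinearMap.det_toLin, Matrix.det_fin_two_of]
  ring

theorem hasFDerivAt_coneMap {u v : ℝ → ℝ} {p : ℝ × ℝ}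
    (h0 : HasDerivAt (fun t => γ t 0) (u p.2) p.2)
    (h1 : HasDerivAt (fun t => γ t 1) (v p.2) p.2) :
    HasFDerivAt (coneMap γ o) (coneDeriv γ o u v p) p := by
  unfold coneDeriv
  rw [Matrix.toLin_finTwoProd_toContinuousLinearMap]
  convert! HasFDerivAt.prodMk (𝕜 := ℝ)
      ((hasFDerivAt_fst.mul
        ((h0.sub_const (o 0)).comp_hasFDerivAt p hasFDerivAt_snd)).const_add (o 0))
      ((hasFDerivAt_fst.mul
        ((h1.sub_const (o 1)).comp_hasFDerivAt p hasFDerivAt_snd)).const_add (o 1)) using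
    2 <;>
  simp [smul_smul, add_comm]

end

theorem eq_zero_of_const_right {f : ℝ → ℝ} {f' x z : ℝ} (hxz : x < z) (hf : HasDerivAt f f' x)
    (h : ∀ y ∈ Icc x z, f y = f x) : f' = 0 := by
  have hx : x ∈ Icc x z := left_mem_Icc.2 hxz.le
  refine UniqueDiffWithinAt.eq_deriv (Icc x z) (uniqueDiffOn_Icc hxz x hx)
    hf.hasDerivWithinAt ?_
  exact (hasDerivWithinAt_const x (Icc x z) (f x)).congr h rfl

theorem Convex.eq_of_smul_sub_eq {E : Type*} [AddCommGroup E] [Module ℝ E] [TopologicalSpace E]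
    [IsTopologicalAddGroup E] [ContinuousConstSMul ℝ E]
    {K : Set E} (hK : Convex ℝ K) {o x y : E} (ho : o ∈ interior K)
    (hx : x ∈ frontier K) (hy : y ∈ frontier K) {r s : ℝ} (hr : 0 < r) (hs : 0 < s)
    (h : r • (x - o) = s • (y - o)) : r = s ∧ x = y := by
  have hlt : ∀ {x y : E} {r s : ℝ}, x ∈ frontier K → y ∈ frontier K → 0 < r → 0 < s →
      r • (x - o) = s • (y - o) → ¬ r < s := by
    intro x y r s hx hy hr hs h hlt
    refine hy.2 ?_
    have := hK.add_smul_sub_mem_interior' hx.1 ho (t := 1 - r / s)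
      ⟨by rw [sub_pos, div_lt_one hs]; exact hlt, by linarith [div_pos hr hs]⟩
    convert this
    have h2 : y - o = (r / s) • (x - o) := by
      rw [div_eq_inv_mul, mul_smul, h, inv_smul_smul₀ hs.ne']
    have h3 : y = o + (r / s) • (x - o) := by rw [← h2]; abel
    rw [h3]
    module
  have hrs : r = s := le_antisymm (not_lt.1 (hlt hy hx hs hr h.symm)) (not_lt.1 (hlt hx hy hr hs h))
  subst hrs
  exact ⟨rfl, sub_left_injective (smul_right_injective E hr.ne' h)⟩

theorem exists_mem_frontier_of_mem_interior {E : Type*} [NormedAddCommGroup E] [NormedSpace ℝ E]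
    {K : Set E} (hK : Bornology.IsBounded K) {o x : E} (hx : x ∈ interior K) (hxo : x ≠ o) :
    ∃ p ∈ frontier K, ∃ r ∈ Ioo (0 : ℝ) 1, x = o + r • (p - o) := by
  obtain ⟨R, hR⟩ := hK.subset_closedBall o
  have hxR := hR (interior_subset hx)
  rw [Metric.mem_closedBall, dist_eq_norm] at hxR
  have hR0 : 0 ≤ R := (norm_nonneg _).trans hxR
  have hd : 0 < ‖x - o‖ := norm_pos_iff.2 (sub_ne_zero.2 hxo)
  have hcont : Continuous fun t : ℝ => o + t • (x - o) := by fun_prop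
  have hconn : IsPreconnected ((fun t : ℝ => o + t • (x - o)) '' Ici 1) :=
    isPreconnected_Ici.image _ hcont.continuousOn
  have hmem : x ∈ (fun t : ℝ => o + t • (x - o)) '' Ici 1 := ⟨1, by simp, by simp⟩
  obtain ⟨t, ht, hp⟩ : ∃ t ∈ Ici (1 : ℝ), o + t • (x - o) ∈ frontier K := by
    by_contra! hne
    have hfar : o + (R / ‖x - o‖ + 1) • (x - o) ∉ closure K := fun hmem => by
      have := closure_minimal hR Metric.isClosed_closedBall hmem
      rw [Metric.mem_closedBall, dist_eq_norm, add_sub_cancel_left, norm_smul, Real.norm_eq_abs,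
        abs_of_pos (by positivity), add_mul, div_mul_cancel₀ _ hd.ne'] at this
      linarith
    obtain ⟨q, -, hq, hq'⟩ := hconn (interior K) (closure K)ᶜ isOpen_interior
      isClosed_closure.isOpen_compl (by
        rintro _ ⟨t, ht, rfl⟩
        by_contra hc
        simp only [mem_union, mem_compl_iff, not_or, not_not] at hc
        exact hne t ht ⟨hc.2, hc.1⟩) ⟨x, hmem, hx⟩
      ⟨_, ⟨R / ‖x - o‖ + 1, by simp; positivity, rfl⟩, hfar⟩
    exact hq' (interior_subset_closure hq)
  have ht' : t ≠ 1 := by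
    rintro rfl
    exact hp.2 (by simpa using hx)
  have ht1 : 1 < t := lt_of_le_of_ne ht ht'.symm
  refine ⟨_, hp, t⁻¹, ⟨by positivity, inv_lt_one_of_one_lt₀ ht1⟩, ?_⟩
  rw [add_sub_cancel_left, smul_smul, inv_mul_cancel₀ (by positivity)]
  simp

namespace ArcParam
variable {K : Set (EuclideanSpace ℝ (Fin 2))} {γ : ℝ → EuclideanSpace ℝ (Fin 2)}
    {S : ℝ → ℝ} {P : ℝ} (h : ArcParam K γ S P)
include h

theorem mem_frontier (θ : ℝ) : γ θ ∈ frontier K := mem_frontier_of_isMax (h.mem θ) (h.max θ)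

theorem ae_hasDerivAt : ∀ᵐ θ, HasDerivAt (fun t => γ t 0) (-(deriv S θ * sin θ)) θ ∧
    HasDerivAt (fun t => γ t 1) (deriv S θ * cos θ) θ := by
  filter_upwards [h.arc.ae_hasDerivAt_integral_mul continuous_sin 0,
    h.arc.ae_hasDerivAt_integral_mul continuous_cos 0] with θ h1 h2
  constructor
  · have : (fun t => γ t 0) = fun t => γ 0 0 + -∫ r in (0 : ℝ)..t, deriv S r * sin r := by
      ext t
      rw [← h.int_zero, add_sub_cancel]
    rw [this]
    exact h1.neg.const_add _
  · have : (fun t => γ t 1) = fun t => γ 0 1 + ∫ r in (0 : ℝ)..t, deriv S r * cos r := by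
      ext t
      rw [← h.int_one, add_sub_cancel]
    rw [this]
    exact h2.const_add _

omit h in
theorem deriv_eq_zero_of_const {θ z : ℝ} (hz : θ < z)
    (hd : HasDerivAt (fun t => γ t 0) (-(deriv S θ * sin θ)) θ ∧
      HasDerivAt (fun t => γ t 1) (deriv S θ * cos θ) θ)
    (hc : ∀ r ∈ Icc θ z, γ r = γ θ) : deriv S θ = 0 := by
  have h0 := eq_zero_of_const_right hz hd.1 fun y hy => by rw [hc y hy]
  have h1 := eq_zero_of_const_right hz hd.2 fun y hy => by rw [hc y hy]
  linear_combination (-sin θ) * h0 + cos θ * h1 - deriv S θ * sin_sq_add_cos_sq θ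

theorem comp_sub_pos {o : EuclideanSpace ℝ (Fin 2)} (ho : o ∈ interior K) (θ : ℝ) :
    0 < comp θ (γ θ - o) := by
  obtain ⟨y, hy, hlt⟩ := exists_comp_lt_of_mem_interior ho θ
  rw [comp_sub]
  linarith [h.max θ y hy]

theorem injOn_coneMap {o : EuclideanSpace ℝ (Fin 2)} (ho : o ∈ interior K) {a : ℝ} {T : Set ℝ}
    (hT : T ⊆ Ioo a (a + 2 * π))
    (hd : ∀ θ ∈ T, HasDerivAt (fun t => γ t 0) (-(deriv S θ * sin θ)) θ ∧
      HasDerivAt (fun t => γ t 1) (deriv S θ * cos θ) θ)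
    (hρ : ∀ θ ∈ T, deriv S θ ≠ 0) : InjOn (coneMap γ o) (Ioo 0 1 ×ˢ T) := by
  have key : ∀ s ∈ T, ∀ t ∈ T, γ s = γ t → ¬ s < t := by
    intro s hs t ht heq hlt
    have h1 := hT hs
    have h2 := hT ht
    rcases h.const_or_const hlt.le (by linarith [h1.1, h2.2]) heq with hc | hc
    · exact hρ s hs (deriv_eq_zero_of_const hlt (hd s hs) hc)
    · refine hρ t ht (deriv_eq_zero_of_const (z := s + 2 * π) ?_ (hd t ht) ?_)
      · linarith [h1.1, h2.2]
      · rwa [← heq]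
  rintro ⟨r, s⟩ ⟨hr, hs⟩ ⟨r', t⟩ ⟨hr', ht⟩ heq
  simp only at hr hs hr' ht
  rw [coneMap_eq, coneMap_eq] at heq
  have heq' := add_left_cancel (planeCoord.injective heq)
  obtain ⟨h1, h2⟩ := h.convex.eq_of_smul_sub_eq ho (h.mem_frontier s) (h.mem_frontier t)
    hr.1 hr'.1 heq'
  have h3 : s = t := le_antisymm (not_lt.1 (key t ht s hs h2.symm)) (not_lt.1 (key s hs t ht h2))
  rw [h1, h3]

theorem abs_coord_sub_le (i : Fin 2) (s t : ℝ) : |γ s i - γ t i| ≤ |s - t| := by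
  have h1 : |(γ s - γ t) i| ≤ ‖γ s - γ t‖ := by simpa using PiLp.norm_apply_le (γ s - γ t) i
  rw [← dist_eq_norm] at h1
  exact h1.trans ((h.dist_le s t).trans (h.arc.abs_sub_le s t))

theorem volume_coneMap_image_eq_zero (o : EuclideanSpace ℝ (Fin 2)) {Z : Set ℝ}
    (hZ : volume Z = 0) : volume (coneMap γ o '' (Ioo 0 1 ×ˢ Z)) = 0 := by
  obtain ⟨R, hR⟩ := h.compact.isBounded.subset_closedBall o
  have hM : ∀ i t, |γ t i - o i| ≤ R := by
    intro i t
    have h1 : |(γ t - o) i| ≤ ‖γ t - o‖ := by simpa using PiLp.norm_apply_le (γ t - o) i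
    rw [← dist_eq_norm] at h1
    exact h1.trans (hR (h.mem t))
  have hR0 : 0 ≤ R := (abs_nonneg _).trans (hM 0 0)
  have hlip : LipschitzOnWith ⟨R + 1, by linarith⟩ (coneMap γ o) (Ioo 0 1 ×ˢ Z) := by
    refine LipschitzOnWith.of_dist_le_mul ?_
    rintro ⟨r, s⟩ ⟨hr, -⟩ ⟨r', t⟩ ⟨hr', -⟩
    have hco : ∀ i, |o i + r * (γ s i - o i) - (o i + r' * (γ t i - o i))| ≤
        (R + 1) * (|r - r'| ⊔ |s - t|) := by
      intro i
      have e : o i + r * (γ s i - o i) - (o i + r' * (γ t i - o i)) =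
        (r - r') * (γ t i - o i) + r * (γ s i - γ t i) := by ring
      rw [e]
      refine (abs_add_le _ _).trans ?_
      rw [abs_mul, abs_mul, abs_of_pos hr.1]
      have h1 : |r - r'| * |γ t i - o i| ≤ (|r - r'| ⊔ |s - t|) * R :=
        mul_le_mul (le_max_left _ _) (hM i t) (abs_nonneg _) (by positivity)
      have h2 : r * |γ s i - γ t i| ≤ 1 * (|r - r'| ⊔ |s - t|) :=
        mul_le_mul hr.2.le ((h.abs_coord_sub_le i s t).trans (le_max_right _ _)) (abs_nonneg _)
          zero_le_one
      linarith
    rw [Prod.dist_eq, Prod.dist_eq]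
    simp only [Real.dist_eq, coneMap]
    exact max_le (hco 0) (hco 1)
  have hz : (μH[2] : Measure (ℝ × ℝ)) (Ioo 0 1 ×ˢ Z) = 0 := by
    rw [hausdorffMeasure_prod_real, Measure.volume_eq_prod, Measure.prod_prod, hZ, mul_zero]
  have := hlip.hausdorffMeasure_image_le (d := 2) zero_le_two
  rw [hz, mul_zero, hausdorffMeasure_prod_real] at this
  exact le_antisymm this zero_le

omit h in
theorem det_coneDeriv_eq (o : EuclideanSpace ℝ (Fin 2)) (p : ℝ × ℝ) :
    (coneDeriv γ o (fun θ => -(deriv S θ * sin θ)) (fun θ => deriv S θ * cos θ) p).det =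
      p.1 * (deriv S p.2 * comp p.2 (γ p.2 - o)) := by
  rw [det_coneDeriv, comp, PiLp.sub_apply, PiLp.sub_apply]
  ring

theorem planeCoord_image_subset {o : EuclideanSpace ℝ (Fin 2)} (a : ℝ) :
    planeCoord '' K ⊆ coneMap γ o '' (Ioo 0 1 ×ˢ Icc a (a + 2 * π)) ∪
      planeCoord '' (frontier K ∪ {o}) := by
  rintro _ ⟨x, hx, rfl⟩
  by_cases hxf : x ∈ frontier K ∪ {o}
  · exact .inr ⟨x, hxf, rfl⟩
  · left
    simp only [mem_union, mem_singleton_iff, not_or] at hxf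
    have hxi : x ∈ interior K := by
      by_contra hxi
      exact hxf.1 ⟨subset_closure hx, hxi⟩
    obtain ⟨p, hp, r, hr, rfl⟩ :=
      exists_mem_frontier_of_mem_interior h.compact.isBounded hxi hxf.2
    rw [h.frontier_eq_image a] at hp
    obtain ⟨θ, hθ, rfl⟩ := hp
    exact ⟨(r, θ), ⟨hr, hθ⟩, coneMap_eq γ o _⟩

theorem volume_eq_of_mem_interior {o : EuclideanSpace ℝ (Fin 2)} (ho : o ∈ interior K) (a : ℝ) :
    volume K = ENNReal.ofReal
      (1 / 2 * ∫ θ in a..(a + 2 * π), deriv S θ * comp θ (γ θ - o)) := by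
  set Q : ℝ → Prop := fun θ => HasDerivAt (fun t => γ t 0) (-(deriv S θ * sin θ)) θ ∧
    HasDerivAt (fun t => γ t 1) (deriv S θ * cos θ) θ with hQ
  set B := toMeasurable volume {θ | ¬ Q θ} with hB
  have hB0 : volume B = 0 := by rw [hB, measure_toMeasurable]; exact h.ae_hasDerivAt
  have hQB : ∀ θ ∉ B, Q θ := fun θ hθ => by
    by_contra hn
    exact hθ (subset_toMeasurable _ _ hn)
  have hρm : Measurable (deriv S) := measurable_deriv S
  set T₁ := (Ioo a (a + 2 * π) \ B) ∩ {θ | deriv S θ ≠ 0} with hT₁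
  set T₀ := (Ioo a (a + 2 * π) \ B) ∩ {θ | deriv S θ = 0} with hT₀
  have hT₁m : MeasurableSet T₁ :=
    (measurableSet_Ioo.diff (measurableSet_toMeasurable _ _)).inter
      (hρm (measurableSet_singleton 0)).compl
  set Z := B ∪ {a, a + 2 * π} with hZ
  have hZ0 : volume Z = 0 := by
    rw [hZ, measure_union_null_iff]
    exact ⟨hB0, (Set.toFinite _).measure_zero _⟩
  set J := coneDeriv γ o (fun θ => -(deriv S θ * sin θ)) (fun θ => deriv S θ * cos θ) with hJ
  have hdet : ∀ p, (J p).det = p.1 * (deriv S p.2 * comp p.2 (γ p.2 - o)) :=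
    det_coneDeriv_eq o
  have hF₁ : ∀ p ∈ Ioo (0 : ℝ) 1 ×ˢ T₁,
      HasFDerivWithinAt (coneMap γ o) (J p) (Ioo (0 : ℝ) 1 ×ˢ T₁) p := fun p hp =>
    (hasFDerivAt_coneMap (hQB p.2 hp.2.1.2).1 (hQB p.2 hp.2.1.2).2).hasFDerivWithinAt
  have hnull₀ : volume (coneMap γ o '' (Ioo 0 1 ×ˢ T₀)) = 0 := by
    have hT₀m : MeasurableSet T₀ :=
      (measurableSet_Ioo.diff (measurableSet_toMeasurable _ _)).inter
        (hρm (measurableSet_singleton 0))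
    have hm := measurableSet_Ioo (a := (0 : ℝ)) (b := 1) |>.prod hT₀m
    refine le_antisymm ((addHaar_image_le_lintegral_abs_det_fderiv volume hm (f' := J) fun p hp =>
      (hasFDerivAt_coneMap (hQB p.2 hp.2.1.2).1 (hQB p.2 hp.2.1.2).2).hasFDerivWithinAt).trans
      ?_) zero_le
    rw [setLIntegral_congr_fun (g := fun _ => 0) hm fun p hp => ?_]
    · simp
    · have h0 : deriv S p.2 = 0 := hp.2.2
      simp [hdet, h0]
  have hfront : volume (planeCoord '' (frontier K ∪ {o})) = 0 := by
    rw [volume_planeCoord_image, measure_union_null_iff]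
    exact ⟨h.convex.addHaar_frontier _, measure_singleton o⟩
  have hcover : planeCoord '' K ⊆ coneMap γ o '' (Ioo 0 1 ×ˢ T₁) ∪
      (coneMap γ o '' (Ioo 0 1 ×ˢ T₀) ∪ (coneMap γ o '' (Ioo 0 1 ×ˢ Z) ∪
        planeCoord '' (frontier K ∪ {o}))) := by
    refine (h.planeCoord_image_subset (o := o) a).trans ?_
    rintro q (⟨⟨r, θ⟩, ⟨hr, hθ⟩, rfl⟩ | hq)
    · simp only at hr hθ
      by_cases hz : θ ∈ Z
      · exact .inr (.inr (.inl ⟨(r, θ), ⟨hr, hz⟩, rfl⟩))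
      · simp only [hZ, mem_union, mem_insert_iff, mem_singleton_iff, not_or] at hz
        have hoo : θ ∈ Ioo a (a + 2 * π) :=
          ⟨lt_of_le_of_ne hθ.1 (Ne.symm hz.2.1), lt_of_le_of_ne hθ.2 hz.2.2⟩
        by_cases h0 : deriv S θ = 0
        · exact .inr (.inl ⟨(r, θ), ⟨hr, ⟨hoo, hz.1⟩, h0⟩, rfl⟩)
        · exact .inl ⟨(r, θ), ⟨hr, ⟨hoo, hz.1⟩, h0⟩, rfl⟩
    · exact .inr (.inr (.inr hq))
  have hsub : coneMap γ o '' (Ioo 0 1 ×ˢ T₁) ⊆ planeCoord '' K := by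
    rintro _ ⟨⟨r, θ⟩, ⟨hr, -⟩, rfl⟩
    rw [coneMap_eq]
    exact ⟨_, h.convex.add_smul_sub_mem (interior_subset ho) (h.mem θ) ⟨hr.1.le, hr.2.le⟩, rfl⟩
  have hvol : volume K = volume (coneMap γ o '' (Ioo 0 1 ×ˢ T₁)) := by
    rw [← volume_planeCoord_image K]
    refine le_antisymm ((measure_mono hcover).trans ?_) (measure_mono hsub)
    refine (measure_union_le _ _).trans ?_
    rw [measure_union_null hnull₀ (measure_union_null (h.volume_coneMap_image_eq_zero o hZ0)
      hfront), add_zero]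
  have hk : Continuous fun θ => comp θ (γ θ - o) := by
    have := h.continuous
    fun_prop
  have hkm : Measurable fun θ => deriv S θ * comp θ (γ θ - o) := hρm.mul hk.measurable
  have hk0 : ∀ θ, 0 ≤ deriv S θ * comp θ (γ θ - o) := fun θ =>
    mul_nonneg (h.arc.deriv_nonneg θ) (h.comp_sub_pos ho θ).le
  have hr : ∫⁻ r in Ioo (0 : ℝ) 1, ENNReal.ofReal r = ENNReal.ofReal (1 / 2) := by
    rw [← ofReal_integral_eq_lintegral_ofReal]
    · rw [← integral_Ioc_eq_integral_Ioo, ← intervalIntegral.integral_of_le zero_le_one,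
        integral_id]
      norm_num
    · exact (continuous_id.integrableOn_Icc).mono_set Ioo_subset_Icc_self
    · filter_upwards [ae_restrict_mem measurableSet_Ioo] with r hr using hr.1.le
  have hθ : ∫⁻ θ in T₁, ENNReal.ofReal (deriv S θ * comp θ (γ θ - o)) =
      ENNReal.ofReal (∫ θ in a..(a + 2 * π), deriv S θ * comp θ (γ θ - o)) := by
    have hle : a ≤ a + 2 * π := by linarith [pi_pos]
    rw [intervalIntegral.integral_of_le hle, ofReal_integral_eq_lintegral_ofReal]
    · rw [← lintegral_indicator hT₁m, ← lintegral_indicator measurableSet_Ioc]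
      refine lintegral_congr_ae ?_
      filter_upwards [measure_eq_zero_iff_ae_notMem.1 hZ0] with θ hz
      simp only [hZ, mem_union, mem_insert_iff, mem_singleton_iff, not_or] at hz
      by_cases hoo : θ ∈ Ioc a (a + 2 * π)
      · rw [indicator_of_mem hoo]
        by_cases h0 : deriv S θ = 0
        · rw [indicator_of_notMem fun hT => hT.2 h0, h0, zero_mul, ENNReal.ofReal_zero]
        · exact indicator_of_mem
            (show θ ∈ T₁ from ⟨⟨⟨hoo.1, lt_of_le_of_ne hoo.2 hz.2.2⟩, hz.1⟩, h0⟩) _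
      · rw [indicator_of_notMem hoo,
          indicator_of_notMem fun hT => hoo ⟨hT.1.1.1, hT.1.1.2.le⟩]
    · exact (intervalIntegrable_iff_integrableOn_Ioc_of_le hle).1
        (h.arc.intervalIntegrable_mul hk _ _)
    · exact Eventually.of_forall hk0
  rw [hvol, ← lintegral_abs_det_fderiv_eq_addHaar_image volume (measurableSet_Ioo.prod hT₁m) hF₁
    (h.injOn_coneMap ho (fun θ hθ => hθ.1.1) (fun θ hθ => hQB θ hθ.1.2) fun θ hθ => hθ.2)]
  calc ∫⁻ p in Ioo (0 : ℝ) 1 ×ˢ T₁, ENNReal.ofReal |(J p).det|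
      = ∫⁻ p in Ioo (0 : ℝ) 1 ×ˢ T₁, ENNReal.ofReal p.1 *
          ENNReal.ofReal (deriv S p.2 * comp p.2 (γ p.2 - o)) := by
        refine setLIntegral_congr_fun (measurableSet_Ioo.prod hT₁m) fun p hp => ?_
        rw [hdet, abs_of_nonneg (mul_nonneg hp.1.1.le (hk0 _)), ENNReal.ofReal_mul hp.1.1.le]
    _ = (∫⁻ r in Ioo (0 : ℝ) 1, ENNReal.ofReal r) *
          ∫⁻ θ in T₁, ENNReal.ofReal (deriv S θ * comp θ (γ θ - o)) := by
        rw [Measure.volume_eq_prod, ← Measure.prod_restrict]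
        exact lintegral_prod_mul (f := fun r => ENNReal.ofReal r)
          (g := fun θ => ENNReal.ofReal (deriv S θ * comp θ (γ θ - o)))
          ENNReal.measurable_ofReal.aemeasurable (hkm.ennreal_ofReal.aemeasurable)
    _ = _ := by rw [hr, hθ, ENNReal.ofReal_mul (by norm_num)]

end ArcParam

namespace ArcParam
variable {K : Set (EuclideanSpace ℝ (Fin 2))} {γ : ℝ → EuclideanSpace ℝ (Fin 2)}
    {S : ℝ → ℝ} {P : ℝ} (h : ArcParam K γ S P)
include h

theorem volume_eq_arcArea (a : ℝ) :
    volume K = ENNReal.ofReal (1 / 2 * arcArea S a (a + 2 * π)) := by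
  obtain ⟨o, ho⟩ := h.interior_nonempty
  rw [h.volume_eq_of_mem_interior ho a]
  congr 2
  have hin : ∀ θ, comp θ (γ θ - o) = arcInner S a θ + comp θ (γ a - o) := by
    intro θ
    have h0 := h.int_zero a θ
    have h1 := h.int_one a θ
    rw [arcInner, ← h1, comp, comp]
    simp only [PiLp.sub_apply]
    linear_combination (cos θ) * h0
  have hzero : ∫ θ in a..(a + 2 * π), deriv S θ * comp θ (γ a - o) = 0 := by
    have e : ∀ θ, deriv S θ * comp θ (γ a - o) =
        (γ a - o) 0 * (deriv S θ * cos θ) + (γ a - o) 1 * (deriv S θ * sin θ) := by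
      intro θ
      rw [comp]
      ring
    simp only [e]
    rw [intervalIntegral.integral_add
      ((h.arc.intervalIntegrable_mul continuous_cos _ _).const_mul _)
      ((h.arc.intervalIntegrable_mul continuous_sin _ _).const_mul _),
      intervalIntegral.integral_const_mul, intervalIntegral.integral_const_mul,
      h.integral_cos_eq_zero, h.integral_sin_eq_zero]
    ring
  simp only [hin, mul_add]
  rw [intervalIntegral.integral_add, hzero, add_zero, arcArea]
  · exact h.arc.intervalIntegrable_mul (h.arc.continuous_arcInner a) _ _
  · exact h.arc.intervalIntegrable_mul (by fun_prop) _ _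

theorem integral_mul_of_arcLength_eq {s t : ℝ} (hst : s ≤ t) (heq : S s = S t) (k : ℝ → ℝ) :
    ∫ θ in s..t, deriv S θ * k θ = 0 := by
  apply intervalIntegral.integral_zero_ae
  filter_upwards [compl_mem_ae_iff.2 (measure_singleton (μ := (volume : Measure ℝ)) t)] with θ hne hθ
  rw [uIoc_of_le hst] at hθ
  have hoo : θ ∈ Ioo s t := ⟨hθ.1, lt_of_le_of_ne hθ.2 hne⟩
  have : S =ᶠ[𝓝 θ] fun _ => S s := by
    filter_upwards [Ioo_mem_nhds hoo.1 hoo.2] with r hr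
    exact le_antisymm (heq ▸ h.arc.mono hr.2.le) (h.arc.mono hr.1.le)
  rw [this.deriv_eq, deriv_const, zero_mul]

theorem ae_deriv_eq_one {s t : ℝ} {c : EuclideanSpace ℝ (Fin 2)}
    (hc : ∀ θ ∈ Ioo s t, γ θ = c + dir θ) : ∀ᵐ θ, θ ∈ Ioc s t → deriv S θ = 1 := by
  filter_upwards [compl_mem_ae_iff.2 (measure_singleton (μ := (volume : Measure ℝ)) t),
    h.ae_hasDerivAt] with θ hne hd hθ
  have hoo : θ ∈ Ioo s t := ⟨hθ.1, lt_of_le_of_ne hθ.2 hne⟩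
  have hev : ∀ᶠ r in 𝓝 θ, γ r = c + dir r := by
    filter_upwards [Ioo_mem_nhds hoo.1 hoo.2] with r hr using hc r hr
  have e0 : HasDerivAt (fun t => γ t 0) (-sin θ) θ := by
    refine ((hasDerivAt_cos θ).const_add (c 0)).congr_of_eventuallyEq ?_
    filter_upwards [hev] with r hr
    rw [hr]
    simp
  have e1 : HasDerivAt (fun t => γ t 1) (cos θ) θ := by
    refine ((hasDerivAt_sin θ).const_add (c 1)).congr_of_eventuallyEq ?_
    filter_upwards [hev] with r hr
    rw [hr]
    simp
  have u0 := e0.unique hd.1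
  have u1 := e1.unique hd.2
  linear_combination (sin θ) * u0 - cos θ * u1 - (deriv S θ - 1) * sin_sq_add_cos_sq θ

end ArcParam

section Lens
variable {c₁ c₂ : EuclideanSpace ℝ (Fin 2)} {α β : ℝ}

theorem lens_support_mem (hα0 : 0 ≤ α) (hα : α ≤ π / 2) (hc : c₁ - c₂ = (2 * cos α) • dir β)
    {θ : ℝ} (hθ : |θ - β| ≤ α) :
    c₂ + dir θ ∈ Metric.closedBall c₁ 1 ∩ Metric.closedBall c₂ 1 := by
  constructor
  · rw [Metric.mem_closedBall, dist_eq_norm,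
      show c₂ + dir θ - c₁ = dir θ - (c₁ - c₂) by abel, hc]
    have h1 := comp_sq_add_sq θ (dir θ - (2 * cos α) • dir β)
    rw [comp_sub, comp_sub, comp_smul, comp_smul, comp_dir, comp_dir, comp_dir, comp_dir, sub_self,
      add_sub_cancel_left, cos_zero, cos_pi_div_two,
      show θ + π / 2 - β = θ - β + π / 2 by ring, cos_add_pi_div_two] at h1
    have h2 : cos α ≤ cos (θ - β) := by
      rw [← cos_abs (θ - β)]
      exact cos_le_cos_of_nonneg_of_le_pi (abs_nonneg _) (by linarith [pi_pos]) hθ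
    have h3 : 0 ≤ cos α := cos_nonneg_of_mem_Icc ⟨by linarith [pi_pos], hα⟩
    have h4 := mul_le_mul_of_nonneg_left h2 h3
    have h5 := sin_sq_add_cos_sq (θ - β)
    have h6 : ‖dir θ - (2 * cos α) • dir β‖ ^ 2 ≤ 1 := by
      rw [← h1]
      nlinarith
    nlinarith [norm_nonneg (dir θ - (2 * cos α) • dir β)]
  · rw [Metric.mem_closedBall, dist_eq_norm, add_sub_cancel_left, norm_dir]

end Lens

namespace ArcParam
variable {γ : ℝ → EuclideanSpace ℝ (Fin 2)} {S : ℝ → ℝ} {P : ℝ}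
  {c₁ c₂ : EuclideanSpace ℝ (Fin 2)} {α β : ℝ}
  (h : ArcParam (Metric.closedBall c₁ 1 ∩ Metric.closedBall c₂ 1) γ S P)
  (hα0 : 0 < α) (hα : α ≤ π / 2) (hc : c₁ - c₂ = (2 * cos α) • dir β)
include h hα0 hα hc

theorem lens_support_eq {θ : ℝ} (hθ : |θ - β| ≤ α) : γ θ = c₂ + dir θ := by
  refine (h.uniq θ _ (lens_support_mem hα0.le hα hc hθ) fun y hy => ?_).symm
  have h1 := comp_le_norm θ (y - c₂)
  rw [← dist_eq_norm, comp_sub] at h1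
  rw [comp_add, comp_dir_self]
  linarith [Metric.mem_closedBall.1 hy.2]

omit h hα0 hα in
theorem lens_swap : c₂ - c₁ = (2 * cos α) • dir (β + π) := by
  rw [← neg_sub, hc, ← smul_neg]
  congr 1
  ext i
  fin_cases i <;> simp [dir]

theorem lens_corner : γ (β + π - α) = γ (β + α) := by
  have h' : ArcParam (Metric.closedBall c₂ 1 ∩ Metric.closedBall c₁ 1) γ S P := by
    rwa [inter_comm]
  rw [h.lens_support_eq hα0 hα hc (θ := β + α) (by rw [add_sub_cancel_left, abs_of_pos hα0]),
    h'.lens_support_eq hα0 hα (lens_swap hc) (θ := β + π - α) (by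
      rw [show β + π - α - (β + π) = -α by ring, abs_neg, abs_of_pos hα0])]
  rw [sub_eq_iff_eq_add] at hc
  rw [hc]
  ext i
  fin_cases i
  · simp [dir, show β + π - α = β - α + π by ring, cos_add, cos_sub]
    ring
  · simp [dir, show β + π - α = β - α + π by ring, sin_add, sin_sub]
    ring

theorem lens_arcLength_corner : S (β + α) = S (β + π - α) :=
  h.arcLength_eq (by linarith) (by linarith) (h.lens_corner hα0 hα hc).symm

theorem lens_ae_deriv : ∀ᵐ θ, θ ∈ uIoc (β - α) (β + α) → deriv S θ = 1 := by
  rw [uIoc_of_le (by linarith)]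
  refine h.ae_deriv_eq_one (c := c₂) fun θ hθ => h.lens_support_eq hα0 hα hc ?_
  rw [abs_le]
  constructor <;> linarith [hθ.1, hθ.2]

theorem lens_half_length : S (β + π - α) - S (β - α) = 2 * α := by
  rw [← h.lens_arcLength_corner hα0 hα hc, ← h.arc.integral_deriv,
    intervalIntegral.integral_congr_ae (h.lens_ae_deriv hα0 hα hc)]
  simp
  ring

theorem lens_half_area : ∫ θ in (β - α)..(β + π - α),
    deriv S θ * comp θ (γ θ - midpoint ℝ c₁ c₂) = 2 * α - sin (2 * α) := by
  have hcont := h.continuous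
  have hi : ∀ s t, IntervalIntegrable
      (fun θ => deriv S θ * comp θ (γ θ - midpoint ℝ c₁ c₂)) volume s t := fun s t =>
    h.arc.intervalIntegrable_mul (by fun_prop) s t
  rw [← intervalIntegral.integral_add_adjacent_intervals (hi _ (β + α)) (hi _ _),
    h.integral_mul_of_arcLength_eq (by linarith) (h.lens_arcLength_corner hα0 hα hc), add_zero]
  have hm : ∀ θ, comp θ (c₂ + dir θ - midpoint ℝ c₁ c₂) = 1 - cos α * cos (θ - β) := by
    intro θ
    have : c₂ + dir θ - midpoint ℝ c₁ c₂ = dir θ - (1 / 2 : ℝ) • (c₁ - c₂) := by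
      rw [midpoint_eq_smul_add, invOf_eq_inv]
      module
    rw [this, hc, comp_sub, comp_smul, comp_smul, comp_dir_self, comp_dir]
    ring
  have : ∫ θ in (β - α)..(β + α), deriv S θ * comp θ (γ θ - midpoint ℝ c₁ c₂) =
      ∫ θ in (β - α)..(β + α), (1 - cos α * cos (θ - β)) := by
    apply intervalIntegral.integral_congr_ae
    filter_upwards [h.lens_ae_deriv hα0 hα hc] with θ h1 h2
    rw [h1 h2, one_mul]
    rw [uIoc_of_le (by linarith)] at h2
    rw [h.lens_support_eq hα0 hα hc (by rw [abs_le]; constructor <;> linarith [h2.1, h2.2]), hm]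
  rw [this, intervalIntegral.integral_sub, intervalIntegral.integral_const_mul,
    intervalIntegral.integral_comp_sub_right (fun t => cos t), integral_cos]
  · simp [sin_two_mul]
    ring
  · exact intervalIntegrable_const
  · exact Continuous.intervalIntegrable (by fun_prop) _ _

theorem lens_length : P = 4 * α := by
  have h' : ArcParam (Metric.closedBall c₂ 1 ∩ Metric.closedBall c₁ 1) γ S P := by
    rwa [inter_comm]
  have e1 := h.lens_half_length hα0 hα hc
  have e2 := h'.lens_half_length hα0 hα (lens_swap hc)
  have e3 := h.perS (β - α)
  rw [show β + π + π - α = β - α + 2 * π by ring, show β + π - α = β + π - α from rfl] at e2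
  linarith

theorem lens_volume (hm : midpoint ℝ c₁ c₂ ∈
      interior (Metric.closedBall c₁ 1 ∩ Metric.closedBall c₂ 1)) :
    volume (Metric.closedBall c₁ 1 ∩ Metric.closedBall c₂ 1) =
      ENNReal.ofReal (2 * α - sin (2 * α)) := by
  have h' : ArcParam (Metric.closedBall c₂ 1 ∩ Metric.closedBall c₁ 1) γ S P := by
    rwa [inter_comm]
  rw [h.volume_eq_of_mem_interior hm (β - α)]
  have hcont := h.continuous
  have hi : ∀ s t, IntervalIntegrable
      (fun θ => deriv S θ * comp θ (γ θ - midpoint ℝ c₁ c₂)) volume s t := fun s t =>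
    h.arc.intervalIntegrable_mul (by fun_prop) s t
  have e2 := h'.lens_half_area hα0 hα (lens_swap hc)
  rw [show β + π + π - α = β - α + 2 * π by ring, midpoint_comm] at e2
  rw [← intervalIntegral.integral_add_adjacent_intervals (hi _ (β + π - α)) (hi _ _),
    h.lens_half_area hα0 hα hc, e2]
  congr 1
  ring

end ArcParam

theorem midpoint_mem_interior_lens {c₁ c₂ : EuclideanSpace ℝ (Fin 2)} (hd : dist c₁ c₂ < 2) :
    midpoint ℝ c₁ c₂ ∈ interior (Metric.closedBall c₁ 1 ∩ Metric.closedBall c₂ 1) := by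
  rw [interior_inter]
  refine ⟨Metric.ball_subset_interior_closedBall ?_, Metric.ball_subset_interior_closedBall ?_⟩
  · rw [Metric.mem_ball, dist_midpoint_left]
    simp; linarith
  · rw [Metric.mem_ball, dist_midpoint_right]
    simp; linarith

theorem IsLens.isLambdaConvex {n : ℕ} {L : Set (EuclideanSpace ℝ (Fin n))} (hL : IsLens 1 L) :
    IsLambdaConvex 1 L := by
  obtain ⟨c₁, c₂, -, rfl⟩ := hL
  intro p hp
  have hcl : IsClosed (Metric.closedBall c₁ (1 / 1) ∩ Metric.closedBall c₂ (1 / 1)) :=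
    Metric.isClosed_closedBall.inter Metric.isClosed_closedBall
  have hpL := hcl.frontier_subset hp
  by_cases h1 : dist p c₁ = 1 / 1
  · exact ⟨univ, univ_mem, c₁, h1, fun x hx => (hcl.frontier_subset hx.2).1⟩
  by_cases h2 : dist p c₂ = 1 / 1
  · exact ⟨univ, univ_mem, c₂, h2, fun x hx => (hcl.frontier_subset hx.2).2⟩
  refine absurd ?_ hp.2
  rw [interior_inter]
  exact ⟨Metric.ball_subset_interior_closedBall (lt_of_le_of_ne hpL.1 h1),
    Metric.ball_subset_interior_closedBall (lt_of_le_of_ne hpL.2 h2)⟩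

theorem lens_measures {c₁ c₂ : EuclideanSpace ℝ (Fin 2)} {α : ℝ} (hα0 : 0 < α) (hα : α ≤ π / 2)
    (hd : dist c₁ c₂ = 2 * cos α) :
    μH[1] (frontier (Metric.closedBall c₁ 1 ∩ Metric.closedBall c₂ 1)) = ENNReal.ofReal (4 * α) ∧
    volume (Metric.closedBall c₁ 1 ∩ Metric.closedBall c₂ 1) =
      ENNReal.ofReal (2 * α - sin (2 * α)) := by
  have hd2 : dist c₁ c₂ < 2 := by
    have : cos α < cos 0 := cos_lt_cos_of_nonneg_of_le_pi le_rfl (by linarith [pi_pos]) hα0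
    rw [cos_zero] at this
    linarith
  have hm := midpoint_mem_interior_lens hd2
  have hconv : Convex ℝ (Metric.closedBall c₁ 1 ∩ Metric.closedBall c₂ 1) :=
    (convex_closedBall _ _).inter (convex_closedBall _ _)
  have hL : IsLens 1 (Metric.closedBall c₁ 1 ∩ Metric.closedBall c₂ 1) :=
    ⟨c₁, c₂, by simpa using hd2, by simp⟩
  obtain ⟨γ, S, P, h⟩ := exists_arcParam
    ((isCompact_closedBall c₁ 1).inter_right Metric.isClosed_closedBall) hconv ⟨_, hm⟩
    hL.isLambdaConvex
  obtain ⟨β, hβ⟩ := exists_eq_norm_smul_dir (c₁ - c₂)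
  rw [← dist_eq_norm, hd] at hβ
  exact ⟨by rw [h.hausdorffMeasure_frontier, h.lens_length hα0 hα hβ],
    h.lens_volume hα0 hα hβ hm⟩

theorem eq_of_subset_of_volume_eq {n : ℕ} {K L : Set (EuclideanSpace ℝ (Fin n))}
    (hK : IsClosed K) (hLc : IsCompact L) (hLconv : Convex ℝ L) (hLint : (interior L).Nonempty)
    (hKL : K ⊆ L) (hvol : volume K = volume L) : K = L := by
  refine hKL.antisymm ?_
  have hLfin : volume L ≠ ⊤ := hLc.measure_lt_top.ne
  have hsub : interior L ⊆ K := by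
    have h0 : volume (L \ K) = 0 := by
      rw [measure_sdiff hKL hK.measurableSet.nullMeasurableSet (hvol ▸ hLfin), hvol, tsub_self]
    have h1 : interior L \ K = ∅ := by
      refine (isOpen_interior.sdiff hK).eq_empty_of_measure_zero (μ := volume) ?_
      exact measure_mono_null (sdiff_subset_sdiff_left interior_subset) h0
    exact sdiff_eq_empty.1 h1
  calc L = closure (interior L) := by
        rw [hLconv.closure_interior_eq_closure_of_nonempty_interior hLint, hLc.isClosed.closure_eq]
    _ ⊆ K := hK.closure_subset_iff.2 hsub

theorem IsLens.exists_angle {L : Set (EuclideanSpace ℝ (Fin 2))} (hL : IsLens 1 L) :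
    ∃ α, 0 < α ∧ α ≤ π / 2 ∧ μH[1] (frontier L) = ENNReal.ofReal (4 * α) ∧
      volume L = ENNReal.ofReal (2 * α - sin (2 * α)) := by
  obtain ⟨c₁, c₂, hd, rfl⟩ := hL
  rw [div_one] at hd
  rw [div_one]
  have h0 : 0 ≤ dist c₁ c₂ := dist_nonneg
  have hα0 : 0 < arccos (dist c₁ c₂ / 2) := arccos_pos.2 (by linarith)
  have hα : arccos (dist c₁ c₂ / 2) ≤ π / 2 := arccos_le_pi_div_two.2 (by linarith)
  refine ⟨_, hα0, hα, lens_measures hα0 hα ?_⟩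
  rw [cos_arccos (by linarith) (by linarith)]
  ring

theorem dist_sub_dir (p : EuclideanSpace ℝ (Fin 2)) {m n : ℝ} (hmn : m ≤ n) (hn : n - m ≤ 2 * π) :
    dist (p - dir m) (p - dir n) = 2 * sin ((n - m) / 2) := by
  have hs : 0 ≤ sin ((n - m) / 2) := sin_nonneg_of_nonneg_of_le_pi (by linarith) (by linarith)
  rw [dist_sub_left, dist_eq_norm]
  have h1 := comp_sq_add_sq m (dir m - dir n)
  rw [comp_sub, comp_sub, comp_dir, comp_dir, comp_dir, comp_dir, sub_self, add_sub_cancel_left,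
    cos_zero, cos_pi_div_two, show m + π / 2 - n = π / 2 - (n - m) by ring, cos_pi_div_two_sub,
    ← neg_sub n m, cos_neg] at h1
  have h2 : cos (n - m) = 1 - 2 * sin ((n - m) / 2) ^ 2 := by
    have := cos_two_mul ((n - m) / 2)
    rw [show 2 * ((n - m) / 2) = n - m by ring] at this
    rw [this, cos_sq']
    ring
  have h3 := sin_sq_add_cos_sq (n - m)
  refine (pow_left_inj₀ (norm_nonneg _) (by linarith) two_ne_zero).1 ?_
  rw [← h1]
  nlinarith

theorem volume_lens_le_of_perimeter_eq {K L : Set (EuclideanSpace ℝ (Fin 2))}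
    (hKc : IsCompact K) (hKconv : Convex ℝ K) (hKint : (interior K).Nonempty)
    (hK : IsLambdaConvex 1 K) (hL : IsLens 1 L)
    (hper : μH[1] (frontier K) = μH[1] (frontier L)) :
    volume L ≤ volume K ∧ (volume K = volume L ↔ IsLens 1 K) := by
  obtain ⟨γ, S, P, h⟩ := exists_arcParam hKc hKconv hKint hK
  obtain ⟨α, hα0, hα, hLper, hLvol⟩ := hL.exists_angle
  have hP : P = 2 * (2 * α) := by
    rw [h.hausdorffMeasure_frontier, hLper,
      ENNReal.ofReal_eq_ofReal_iff h.length_nonneg (by linarith)] at hper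
    linarith
  obtain ⟨a, ha, haeq⟩ := h.arc.le_arcArea_two_pi (l := 2 * α) (fun x => by rw [h.perS, hP])
    h.integral_cos_eq_zero h.integral_sin_eq_zero
  have hsin : sin (2 * α) ≤ 2 * α := sin_le (by linarith)
  rw [hLvol, h.volume_eq_arcArea a]
  refine ⟨ENNReal.ofReal_le_ofReal (by linarith), fun heq => ?_, fun hlens => ?_⟩
  · rw [ENNReal.ofReal_eq_ofReal_iff (by linarith) (by linarith)] at heq
    obtain ⟨m, n, hmn, hsub, hS⟩ := haeq (by linarith)
    have hγ := h.eq_of_arcLength_eq hS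
    have hd : dist (γ m - dir m) (γ m - dir n) = 2 * cos α := by
      rw [dist_sub_dir _ hmn (by linarith), hsub, ← cos_pi_div_two_sub]
      congr 2
      ring
    have hcos : cos α < 1 := by
      have := cos_lt_cos_of_nonneg_of_le_pi le_rfl (by linarith [pi_pos]) hα0
      rwa [cos_zero] at this
    refine ⟨γ m - dir m, γ m - dir n, by linarith, ?_⟩
    rw [div_one]
    refine eq_of_subset_of_volume_eq hKc.isClosed
      ((isCompact_closedBall _ _).inter_right Metric.isClosed_closedBall)
      ((convex_closedBall _ _).inter (convex_closedBall _ _))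
      ⟨_, midpoint_mem_interior_lens (by linarith)⟩
      (subset_inter (h.subset_closedBall m) (hγ ▸ h.subset_closedBall n)) ?_
    rw [(lens_measures hα0 hα hd).2, h.volume_eq_arcArea a, heq]
  · obtain ⟨α', hα0', -, hKper, hKvol⟩ := hlens.exists_angle
    rw [hKper, hLper, ENNReal.ofReal_eq_ofReal_iff (by linarith) (by linarith)] at hper
    rw [← h.volume_eq_arcArea a, hKvol, show α' = α by linarith]

section Scaling
open scoped Pointwise
variable {n : ℕ} {lam c : ℝ} {K L : Set (EuclideanSpace ℝ (Fin n))}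

theorem frontier_smul_of_ne_zero (hc : c ≠ 0) : frontier (c • K) = c • frontier K :=
  ((Homeomorph.smulOfNeZero c hc).image_frontier K).symm

theorem IsLens.smul (hL : IsLens lam L) (hc : 0 < c) : IsLens (lam / c) (c • L) := by
  obtain ⟨c₁, c₂, hd, rfl⟩ := hL
  refine ⟨c • c₁, c • c₂, ?_, ?_⟩
  · rw [dist_smul₀, norm_of_nonneg hc.le, div_div_eq_mul_div, mul_comm 2 c, mul_div_assoc]
    exact mul_lt_mul_of_pos_left hd hc
  · rw [smul_set_inter₀ hc.ne', smul_closedBall' hc.ne', smul_closedBall' hc.ne',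
      norm_of_nonneg hc.le, one_div_div, mul_one_div]

theorem IsLambdaConvex.smul (hK : IsLambdaConvex lam K) (hc : 0 < c) :
    IsLambdaConvex (lam / c) (c • K) := by
  rw [IsLambdaConvex, frontier_smul_of_ne_zero hc.ne']
  rintro _ ⟨p, hp, rfl⟩
  obtain ⟨U, hU, z, hz, hsub⟩ := hK p hp
  refine ⟨c • U, (smul_mem_nhds_smul_iff₀ hc.ne').2 hU, c • z, ?_, ?_⟩
  · simp only [dist_smul₀, norm_of_nonneg hc.le, hz]
    rw [one_div_div, mul_one_div]
  · rw [← smul_set_inter₀ hc.ne', one_div_div, ← mul_one_div]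
    have := smul_closedBall' hc.ne' z (1 / lam)
    rw [norm_of_nonneg hc.le] at this
    rw [← this]
    exact smul_set_mono hsub

end Scaling

open scoped Pointwise in
theorem stmt_9 (lam : ℝ) (hlam : 0 < lam)
    (K L : Set (EuclideanSpace ℝ (Fin 2)))
    (hKc : IsCompact K) (hKconv : Convex ℝ K) (hKint : (interior K).Nonempty)
    (hK : IsLambdaConvex lam K) (hL : IsLens lam L)
    (hper : μH[1] (frontier K) = μH[1] (frontier L)) :
    volume L ≤ volume K ∧ (volume K = volume L ↔ IsLens lam K) := by
  have hne := hlam.ne'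
  have hvol : ∀ M : Set (EuclideanSpace ℝ (Fin 2)),
      volume (lam • M) = ENNReal.ofReal (lam ^ 2) * volume M := by
    intro M
    rw [Measure.addHaar_smul, finrank_euclideanSpace_fin, abs_of_pos (by positivity)]
  have hpos : ENNReal.ofReal (lam ^ 2) ≠ 0 := by
    rw [Ne, ENNReal.ofReal_eq_zero, not_le]
    positivity
  have hlens : IsLens 1 (lam • K) ↔ IsLens lam K := by
    refine ⟨fun h => ?_, fun h => div_self hne ▸ h.smul hlam⟩
    have := h.smul (inv_pos.2 hlam)
    rwa [inv_smul_smul₀ hne, one_div, inv_inv] at this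
  have key := volume_lens_le_of_perimeter_eq (hKc.smul lam) (hKconv.smul lam)
    (by rw [interior_smul₀ hne]; exact hKint.smul_set)
    (div_self hne ▸ hK.smul hlam) (div_self hne ▸ hL.smul hlam)
    (by rw [frontier_smul_of_ne_zero hne, frontier_smul_of_ne_zero hne,
      Measure.hausdorffMeasure_smul₀ zero_le_one hne,
      Measure.hausdorffMeasure_smul₀ zero_le_one hne, hper])
  rwa [hvol, hvol, hlens, ENNReal.mul_le_mul_iff_right hpos ENNReal.ofReal_ne_top,
    ENNReal.mul_right_inj hpos ENNReal.ofReal_ne_top] at key
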